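/- arXiv:2306.12171 — 2 statements merged into one kernel-verified Lean document; each statement's English description precedes it below -/
import Mathlib

section
/- Let γ : 𝕊¹ → ℝ² be a C¹ immersed closed curve (γ'(t) ≠ 0 for all t) all of whose self-intersection points are transverse. Suppose γ has k self-intersection points counted with multiplicity, i.e. the set S of self-intersection points is finite, every fiber γ⁻¹(p) for p ∈ S is finite, and ∑_{p∈S} (|γ⁻¹(p)| − 1) = k. Then the complement ℝ² \ Image(γ) has exactly k + 1 bounded connected components. -/
open Set Function Bornology

section

open Filter Topology

/-- A function which is eventually constant along a set `D` at every point of a preconnected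
set `s` is constant on `D ∩ s`. -/
theorem IsPreconnected.exists_eq_of_eventually_const {X Y : Type*} [TopologicalSpace X]
    [Nonempty Y] {s D : Set X} (hs : IsPreconnected s) {f : X → Y}
    (hne : ∀ x ∈ s, (𝓝[D] x).NeBot)
    (h : ∀ x ∈ s, ∃ c, ∀ᶠ y in 𝓝[D] x, f y = c) :
    ∃ c, ∀ y ∈ D ∩ s, f y = c := by
  choose! F hF using h
  have hloc : IsLocallyConstant (fun x : s => F x) := by
    rw [IsLocallyConstant.iff_eventually_eq]
    rintro ⟨x, hx⟩
    have h1 := eventually_eventually_nhds.2 (eventually_nhdsWithin_iff.1 (hF x hx))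
    have h2 : ∀ᶠ y in 𝓝 x, y ∈ s → F y = F x := by
      filter_upwards [h1] with y hy hys
      have := hne y hys
      obtain ⟨z, hz1, hz2⟩ := ((eventually_nhdsWithin_iff.2 hy).and (hF y hys)).exists
      exact hz2.symm.trans hz1
    filter_upwards [continuous_subtype_val.continuousAt.eventually h2] with y hy
    exact hy y.2
  have : PreconnectedSpace s := Subtype.preconnectedSpace hs
  have key : ∀ y ∈ D ∩ s, f y = F y := fun y hy =>
    (hF y hy.2).self_of_nhdsWithin hy.1
  by_cases hy : (D ∩ s).Nonempty
  · obtain ⟨x, hx⟩ := hy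
    exact ⟨F x, fun y hy => (key y hy).trans
      (hloc.apply_eq_of_preconnectedSpace ⟨y, hy.2⟩ ⟨x, hx.2⟩)⟩
  · exact ⟨Classical.arbitrary Y, fun y hy' => (hy ⟨y, hy'⟩).elim⟩

theorem Int.eventually_ceil_eq_nhdsGT (x : ℝ) : ∀ᶠ y in 𝓝[>] x, ⌈y⌉ = ⌊x⌋ + 1 := by
  filter_upwards [Ioo_mem_nhdsGT (Int.lt_floor_add_one x)] with y hy
  rw [Int.ceil_eq_iff]
  push_cast
  exact ⟨by linarith [Int.floor_le x, hy.1], hy.2.le⟩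

theorem Int.eventually_ceil_eq_nhdsLT (x : ℝ) : ∀ᶠ y in 𝓝[<] x, ⌈y⌉ = ⌈x⌉ := by
  have : (⌈x⌉ : ℝ) - 1 < x := by linarith [Int.ceil_lt_add_one x]
  filter_upwards [Ioo_mem_nhdsLT this] with y hy
  rw [Int.ceil_eq_iff]
  exact ⟨hy.1, hy.2.le.trans (Int.le_ceil x)⟩

theorem Int.eventually_ceil_eq_nhds {x : ℝ} (hx : ∀ n : ℤ, x ≠ n) : ∀ᶠ y in 𝓝 x, ⌈y⌉ = ⌈x⌉ := by
  have : (⌈x⌉ : ℝ) - 1 < x := by linarith [Int.ceil_lt_add_one x]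
  filter_upwards [Ioo_mem_nhds this (lt_of_le_of_ne (Int.le_ceil x) (hx _))] with y hy
  rw [Int.ceil_eq_iff]
  exact ⟨hy.1, hy.2.le⟩

theorem tendsto_sub_const_nhdsGT {x c y : ℝ} (h : x - c = y) :
    Tendsto (fun z => z - c) (𝓝[>] x) (𝓝[>] y) := by
  subst h
  refine tendsto_nhdsWithin_iff.2
    ⟨((continuous_id.sub continuous_const).tendsto x).mono_left nhdsWithin_le_nhds, ?_⟩
  filter_upwards [self_mem_nhdsWithin] with z hz
  simpa using hz

theorem tendsto_sub_const_nhdsLT {x c y : ℝ} (h : x - c = y) :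
    Tendsto (fun z => z - c) (𝓝[<] x) (𝓝[<] y) := by
  subst h
  refine tendsto_nhdsWithin_iff.2
    ⟨((continuous_id.sub continuous_const).tendsto x).mono_left nhdsWithin_le_nhds, ?_⟩
  filter_upwards [self_mem_nhdsWithin] with z hz
  simpa using hz

/-- The jumps of a periodic step function add up to zero over a period. -/
theorem Function.Periodic.sum_jumps_eq_zero {ι : Type*} [Fintype ι] {g : ℝ → ℂ}
    (hg : Periodic g 1) (θ : ι → ℝ) (d : ι → ℂ)
    (hθ : ∀ i j (n : ℤ), θ i = θ j + n → i = j)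
    (hloc : ∀ x, (∀ i (n : ℤ), x ≠ θ i + n) → ∀ᶠ y in 𝓝 x, g y = g x)
    (hjump : ∀ i, ∃ a b, a - b = d i ∧ (∀ᶠ y in 𝓝[>] (θ i), g y = a) ∧
      ∀ᶠ y in 𝓝[<] (θ i), g y = b) :
    ∑ i, d i = 0 := by
  set h : ℝ → ℂ := fun x => g x - ∑ i, d i * (⌈x - θ i⌉ : ℤ) with hh
  set D : Set ℝ := (⋃ i, range fun n : ℤ => θ i + n)ᶜ with hD
  have hDd : Dense D := by
    refine Set.Countable.dense_compl ℝ ?_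
    exact countable_iUnion fun i => countable_range _
  have hsub : ∀ x i, Tendsto (fun y => y - θ i) (𝓝 x) (𝓝 (x - θ i)) := fun x i =>
    (continuous_id.sub continuous_const).tendsto x
  obtain ⟨c, hc⟩ := (isPreconnected_univ (α := ℝ)).exists_eq_of_eventually_const
    (D := D) (f := h) (fun x _ => mem_closure_iff_nhdsWithin_neBot.1 (hDd x)) (by
      intro x _
      by_cases hx : ∀ i (n : ℤ), x ≠ θ i + n
      · refine ⟨h x, (Eventually.filter_mono nhdsWithin_le_nhds ?_)⟩
        have : ∀ᶠ y in 𝓝 x, ∀ i, ⌈y - θ i⌉ = ⌈x - θ i⌉ := by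
          refine eventually_all.2 fun i => (hsub x i).eventually
            (Int.eventually_ceil_eq_nhds fun n hn => hx i n ?_)
          linarith
        filter_upwards [this, hloc x hx] with y hy hy'
        simp only [hh, hy, hy']
      · push Not at hx
        obtain ⟨i, n, rfl⟩ := hx
        obtain ⟨a, b, hab, hr, hl⟩ := hjump i
        have hgn : ∀ y, g (y - n) = g y := fun y => by
          simpa using hg.sub_zsmul_eq (x := y) n
        have hr' : ∀ᶠ y in 𝓝[>] (θ i + n), g y = a := by
          filter_upwards [(tendsto_sub_const_nhdsGT (add_sub_cancel_right (θ i) (n : ℝ))).eventually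
            hr] with y hy
          rwa [hgn] at hy
        have hl' : ∀ᶠ y in 𝓝[<] (θ i + n), g y = b := by
          filter_upwards [(tendsto_sub_const_nhdsLT (add_sub_cancel_right (θ i) (n : ℝ))).eventually
            hl] with y hy
          rwa [hgn] at hy
        have hoth : ∀ j, j ≠ i → ∀ m : ℤ, θ i + n - θ j ≠ m := by
          intro j hj m hm
          refine hj (hθ j i (n - m) ?_)
          push_cast
          linarith
        classical
        have hfi : ⌊θ i + (n : ℝ) - θ i⌋ = n := by
          rw [add_sub_cancel_left]; exact Int.floor_intCast n
        have hci : ⌈θ i + (n : ℝ) - θ i⌉ = n := by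
          rw [add_sub_cancel_left]; exact Int.ceil_intCast n
        have e1 : ∀ᶠ y in 𝓝[>] (θ i + n), ∀ j, ⌈y - θ j⌉ =
            ⌈θ i + n - θ j⌉ + if j = i then 1 else 0 := by
          refine eventually_all.2 fun j => ?_
          by_cases hj : j = i
          · subst hj
            filter_upwards [(tendsto_sub_const_nhdsGT rfl).eventually
              (Int.eventually_ceil_eq_nhdsGT _)] with y hy
            rw [hy, hfi, hci, if_pos rfl]
          · filter_upwards [((hsub _ j).eventually (Int.eventually_ceil_eq_nhds
              (hoth j hj))).filter_mono nhdsWithin_le_nhds] with y hy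
            rw [hy, if_neg hj, add_zero]
        have e2 : ∀ᶠ y in 𝓝[<] (θ i + n), ∀ j, ⌈y - θ j⌉ = ⌈θ i + n - θ j⌉ :=
          eventually_all.2 fun j => (tendsto_sub_const_nhdsLT rfl).eventually
            (Int.eventually_ceil_eq_nhdsLT _)
        refine ⟨b - ∑ j, d j * (⌈θ i + n - θ j⌉ : ℤ), ?_⟩
        refine Eventually.filter_mono (nhdsWithin_mono (t := {θ i + (n : ℝ)}ᶜ) _ ?_) ?_
        · intro y hy hy'
          exact hy (mem_iUnion.2 ⟨i, n, hy'.symm⟩)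
        · rw [← Iio_union_Ioi, nhdsWithin_union, eventually_sup]
          refine ⟨?_, ?_⟩
          · filter_upwards [hl', e2] with y hy hy'
            simp only [hh, hy, hy']
          · filter_upwards [hr', e1] with y hy hy'
            simp only [hh, hy, hy']
            push_cast
            simp only [mul_add, Finset.sum_add_distrib, mul_ite, mul_one, mul_zero,
              Finset.sum_ite_eq', Finset.mem_univ, if_true, ← hab]
            ring)
  obtain ⟨x, hx⟩ := hDd.nonempty
  have hx1 : x + 1 ∈ D := by
    intro hx'
    obtain ⟨i, n, hn⟩ := mem_iUnion.1 hx'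
    refine hx (mem_iUnion.2 ⟨i, n - 1, ?_⟩)
    simp only at hn ⊢
    push_cast
    linarith
  have h1 := (hc _ ⟨hx1, mem_univ _⟩).trans (hc _ ⟨hx, mem_univ _⟩).symm
  have h2 : ∀ i, ⌈x + 1 - θ i⌉ = ⌈x - θ i⌉ + 1 := fun i => by
    rw [← Int.ceil_add_one]; congr 1; ring
  simp only [hh, hg x, h2] at h1
  push_cast at h1
  simp only [mul_add, Finset.sum_add_distrib, mul_one] at h1
  linear_combination -h1

/-- Parameters of the points which a `1`-periodic curve visits more than once per period. -/
def multipleParams (γ : ℝ → ℂ) : Set ℝ := {t | ∃ s, γ s = γ t ∧ ∀ n : ℤ, s ≠ t + n}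

/-- A `1`-periodic immersed `C¹` curve with finitely many multiple parameters per period. -/
structure IsImmersedLoop (γ : ℝ → ℂ) : Prop where
  periodic : Periodic γ 1
  contDiff : ContDiff ℝ 1 γ
  deriv_ne_zero : ∀ t, deriv γ t ≠ 0
  finite_multipleParams : (multipleParams γ ∩ Ico 0 1).Finite

/-- `f` is locally constant off the curve `γ`. -/
def IsLocConstOff (γ : ℝ → ℂ) (f : ℂ → ℂ) : Prop :=
  ∀ z ∉ range γ, ∀ᶠ y in 𝓝 z, f y = f z

/-- Every path crossing `γ` at `γ t` from right to left avoids `γ` just before and after the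
crossing, and along it `f` passes from the value `b` to the value `a`. -/
def HasSides (γ : ℝ → ℂ) (f : ℂ → ℂ) (t : ℝ) (a b : ℂ) : Prop :=
  ∀ (c : ℝ → ℂ) (c' : ℂ) (x : ℝ), HasDerivAt c c' x → c x = γ t → 0 < (c' / deriv γ t).im →
    (∀ᶠ y in 𝓝[>] x, c y ∉ range γ ∧ f (c y) = a) ∧
      ∀ᶠ y in 𝓝[<] x, c y ∉ range γ ∧ f (c y) = b

/-- The value of `f` increases by `c` across `γ` at `γ t`, from right to left. -/
def HasJump (γ : ℝ → ℂ) (f : ℂ → ℂ) (t : ℝ) (c : ℂ) : Prop :=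
  ∃ a b, HasSides γ f t a b ∧ a - b = c

theorem HasDerivAt.eventually_sign {u : ℝ → ℝ} {u' x : ℝ} (h : HasDerivAt u u' x) (h0 : u x = 0)
    (hu : 0 < u') : (∀ᶠ y in 𝓝[>] x, 0 < u y) ∧ ∀ᶠ y in 𝓝[<] x, u y < 0 := by
  have h1 := (hasDerivAt_iff_tendsto_slope.1 h).eventually (lt_mem_nhds hu)
  constructor
  · filter_upwards [h1.filter_mono (nhdsWithin_mono x fun y (hy : x < y) => hy.ne'),
      self_mem_nhdsWithin] with y hy (hxy : x < y)
    rw [slope_def_field, h0, sub_zero] at hy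
    exact (div_pos_iff_of_pos_right (sub_pos.2 hxy)).1 hy
  · filter_upwards [h1.filter_mono (nhdsWithin_mono x fun y (hy : y < x) => hy.ne),
      self_mem_nhdsWithin] with y hy (hxy : y < x)
    rw [slope_def_field, h0, sub_zero] at hy
    by_contra! h3
    exact absurd (div_nonpos_of_nonneg_of_nonpos h3 (sub_nonpos.2 hxy.le)) (not_le.2 hy)

namespace IsImmersedLoop

variable {γ : ℝ → ℂ} {f : ℂ → ℂ}

theorem apply_add_int (h : IsImmersedLoop γ) (t : ℝ) (n : ℤ) : γ (t + n) = γ t := by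
  simpa using h.periodic.zsmul n t

theorem deriv_add_int (h : IsImmersedLoop γ) (t : ℝ) (n : ℤ) :
    deriv γ (t + n) = deriv γ t := by
  rw [← deriv_comp_add_const]
  simp only [h.apply_add_int]

theorem apply_fract (h : IsImmersedLoop γ) (t : ℝ) : γ (Int.fract t) = γ t := by
  rw [← h.apply_add_int _ ⌊t⌋, Int.fract_add_floor]

theorem continuous (h : IsImmersedLoop γ) : Continuous γ := h.contDiff.continuous

theorem continuous_deriv (h : IsImmersedLoop γ) : Continuous (deriv γ) :=
  h.contDiff.continuous_deriv le_rfl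

theorem hasDerivAt (h : IsImmersedLoop γ) (t : ℝ) : HasDerivAt γ (deriv γ t) t :=
  (h.contDiff.differentiable one_ne_zero t).hasDerivAt

theorem add_int_mem_multipleParams (h : IsImmersedLoop γ) {t : ℝ} (n : ℤ) :
    t + n ∈ multipleParams γ ↔ t ∈ multipleParams γ := by
  constructor
  · rintro ⟨s, hs, hn⟩
    refine ⟨s, hs.trans (h.apply_add_int t n), fun m hm => hn (m - n) ?_⟩
    push_cast; linarith
  · rintro ⟨s, hs, hn⟩
    refine ⟨s, hs.trans (h.apply_add_int t n).symm, fun m hm => hn (n + m) ?_⟩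
    push_cast; linarith

theorem fract_mem_multipleParams (h : IsImmersedLoop γ) {t : ℝ} :
    Int.fract t ∈ multipleParams γ ↔ t ∈ multipleParams γ := by
  rw [← h.add_int_mem_multipleParams ⌊t⌋, Int.fract_add_floor]

theorem exists_eq_add_int {s t : ℝ} (ht : t ∉ multipleParams γ) (hs : γ s = γ t) :
    ∃ n : ℤ, s = t + n := by
  by_contra! hn
  exact ht ⟨s, hs, hn⟩

theorem multipleParams_subset (h : IsImmersedLoop γ) :
    multipleParams γ ⊆ ⋃ q ∈ multipleParams γ ∩ Ico 0 1, range fun n : ℤ => q + n := by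
  intro t ht
  simp only [mem_iUnion]
  exact ⟨Int.fract t, ⟨h.fract_mem_multipleParams.2 ht, Int.fract_nonneg t, Int.fract_lt_one t⟩,
    ⌊t⌋, Int.fract_add_floor t⟩

theorem countable_multipleParams (h : IsImmersedLoop γ) : (multipleParams γ).Countable :=
  (h.finite_multipleParams.countable.biUnion fun _ _ => countable_range _).mono
    h.multipleParams_subset

theorem dense_compl_multipleParams (h : IsImmersedLoop γ) : Dense (multipleParams γ)ᶜ :=
  h.countable_multipleParams.dense_compl ℝ

theorem eventually_notMem_nhdsNE (h : IsImmersedLoop γ) (t : ℝ) :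
    ∀ᶠ s in 𝓝[≠] t, s ∉ multipleParams γ := by
  have key : ∀ q : ℝ, ∀ᶠ s in 𝓝[≠] t, ∀ n : ℤ, s ≠ q + n := by
    intro q
    rw [← Iio_union_Ioi, nhdsWithin_union, eventually_sup]
    have hl : (⌈t - q⌉ : ℝ) - 1 + q < t := by linarith [Int.ceil_lt_add_one (t - q)]
    have hr : t < (⌊t - q⌋ : ℝ) + 1 + q := by linarith [Int.lt_floor_add_one (t - q)]
    constructor
    · filter_upwards [Ioo_mem_nhdsLT hl] with s hs n hn
      have h1 : n < ⌈t - q⌉ := Int.lt_ceil.2 (by linarith [hs.2])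
      have h2 : ⌈t - q⌉ - 1 < n := by
        have : ((⌈t - q⌉ - 1 : ℤ) : ℝ) < n := by push_cast; linarith [hs.1]
        exact_mod_cast this
      omega
    · filter_upwards [Ioo_mem_nhdsGT hr] with s hs n hn
      have h1 : ⌊t - q⌋ < n := Int.floor_lt.2 (by linarith [hs.1])
      have h2 : n < ⌊t - q⌋ + 1 := by
        have : (n : ℝ) < ((⌊t - q⌋ + 1 : ℤ) : ℝ) := by push_cast; linarith [hs.2]
        exact_mod_cast this
      omega
  filter_upwards [(eventually_all_finite h.finite_multipleParams).2 fun q _ => key q] with s hs hsT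
  have := h.multipleParams_subset hsT
  simp only [mem_iUnion] at this
  obtain ⟨q, hq, n, hn⟩ := this
  exact hs q hq n hn.symm

theorem eventually_notMem_nhds (h : IsImmersedLoop γ) {t : ℝ} (ht : t ∉ multipleParams γ) :
    ∀ᶠ s in 𝓝 t, s ∉ multipleParams γ := by
  have := h.eventually_notMem_nhdsNE t
  rw [eventually_nhdsWithin_iff] at this
  filter_upwards [this] with s hs
  rcases eq_or_ne s t with rfl | hne
  exacts [ht, hs hne]

theorem range_eq_image (h : IsImmersedLoop γ) : range γ = γ '' Icc 0 1 := by
  refine subset_antisymm ?_ (image_subset_range _ _)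
  rintro _ ⟨t, rfl⟩
  exact ⟨Int.fract t, ⟨Int.fract_nonneg t, (Int.fract_lt_one t).le⟩, h.apply_fract t⟩

theorem isCompact_range (h : IsImmersedLoop γ) : IsCompact (range γ) :=
  h.range_eq_image ▸ isCompact_Icc.image h.continuous

theorem eventually_fiber_near (h : IsImmersedLoop γ) (p : ℂ) {δ : ℝ} (hδ : 0 < δ) :
    ∀ᶠ z in 𝓝 p, ∀ s, γ s = z → ∃ t, γ t = p ∧ |s - t| < δ := by
  set K : Set ℝ := Icc 0 1 ∩ ⋂ t ∈ γ ⁻¹' {p}, {s | δ ≤ |s - t|} with hK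
  have hKc : IsCompact K := by
    refine isCompact_Icc.inter_right (isClosed_biInter fun t _ => ?_)
    exact isClosed_le continuous_const (by fun_prop)
  have hp : p ∉ γ '' K := by
    rintro ⟨s, hs, hsp⟩
    have := mem_iInter₂.1 hs.2 s hsp
    simp only [mem_ofPred_eq, sub_self, abs_zero] at this
    linarith
  filter_upwards [(hKc.image h.continuous).isClosed.isOpen_compl.mem_nhds hp] with z hz s hs
  by_contra! hcon
  refine hz ⟨Int.fract s, ⟨⟨Int.fract_nonneg s, (Int.fract_lt_one s).le⟩, ?_⟩,
    (h.apply_fract s).trans hs⟩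
  refine mem_iInter₂.2 fun t ht => ?_
  have h1 := hcon (t + ⌊s⌋) ((h.apply_add_int t _).trans ht)
  rw [mem_ofPred_eq]
  rwa [show Int.fract s - t = s - (t + ⌊s⌋) by rw [← Int.self_sub_floor]; ring]

/-- The local structure of a function which is locally constant off the curve near a simple point
of the curve. -/
theorem exists_local_sides (h : IsImmersedLoop γ) (hf : IsLocConstOff γ f) {t : ℝ}
    (ht : t ∉ multipleParams γ) : ∃ a b, HasSides γ f t a b ∧
      (∀ᶠ s in 𝓝 t, ∀ᶠ x : ℝ in 𝓝[>] 0, f (γ s + x * (Complex.I * deriv γ t)) = a ∧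
        f (γ s + (-x : ℝ) * (Complex.I * deriv γ t)) = b) ∧
      ∀ᶠ z in 𝓝 (γ t), z ∉ range γ → f z = a ∨ f z = b := by
  set v := deriv γ t with hv
  have hv0 : v ≠ 0 := h.deriv_ne_zero t
  set Φ : ℂ → ℂ := fun w => γ w.re + w.im * (Complex.I * v) with hΦ
  have hΦc : Continuous Φ := by
    have := h.continuous
    fun_prop
  have hΦt : Φ t = γ t := by simp [hΦ]
  have hΦd : HasStrictDerivAt Φ v t := by
    have h1 : HasStrictDerivAt γ v t := h.contDiff.contDiffAt.hasStrictDerivAt one_ne_zero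
    have h2 : HasStrictFDerivAt Φ _ (t : ℂ) :=
      (HasStrictFDerivAt.comp (t : ℂ) (g := γ) (f := Complex.reCLM)
        h1.hasStrictFDerivAt Complex.reCLM.hasStrictFDerivAt).add
        ((Complex.ofRealCLM.comp Complex.imCLM).hasStrictFDerivAt.mul_const' (Complex.I * v))
    have h3 := h2.isLittleO
    refine HasStrictFDerivAt.of_isLittleO ?_
    refine h3.congr_left fun p => ?_
    generalize p.1 - p.2 = w
    have : (w.re : ℂ) * v + (w.im : ℂ) * (Complex.I * v) = w * v := by
      linear_combination v * Complex.re_add_im w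
    simp [this]
  set e := (hΦd.hasStrictFDerivAt_equiv hv0).toOpenPartialHomeomorph Φ with he
  have hte : (t : ℂ) ∈ e.source :=
    (hΦd.hasStrictFDerivAt_equiv hv0).mem_toOpenPartialHomeomorph_source
  obtain ⟨ψ, hψt, hψd, hψ⟩ : ∃ ψ : ℂ → ℂ, ψ (γ t) = t ∧ HasDerivAt ψ v⁻¹ (γ t) ∧
      ∀ᶠ z in 𝓝 (γ t), Φ (ψ z) = z := by
    refine ⟨hΦd.localInverse Φ v t hv0, ?_, ?_, ?_⟩
    · rw [← hΦt]
      exact (hΦd.hasStrictFDerivAt_equiv hv0).localInverse_apply_image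
    · rw [← hΦt]
      exact (hΦd.to_localInverse hv0).hasDerivAt
    · rw [← hΦt]
      exact (hΦd.hasStrictFDerivAt_equiv hv0).eventually_right_inverse
  obtain ⟨δ, hδ, hδe⟩ : ∃ δ > 0, ∀ w : ℂ, |w.re - t| < δ → |w.im| < δ → w ∈ e.source := by
    obtain ⟨ε, hε, hball⟩ := Metric.isOpen_iff.1 e.open_source t hte
    refine ⟨ε / 2, half_pos hε, fun w h1 h2 => hball ?_⟩
    rw [Metric.mem_ball, dist_eq_norm]
    calc ‖w - t‖ ≤ |(w - t).re| + |(w - t).im| := Complex.norm_le_abs_re_add_abs_im _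
      _ < ε := by simp; linarith
  obtain ⟨η, hη, hηδ, hηN⟩ : ∃ η > 0, η ≤ δ ∧ ∀ w : ℂ, |w.re - t| < η → |w.im| < η →
      ∀ s, γ s = Φ w → ∃ t', γ t' = γ t ∧ |s - t'| < δ := by
    have h1 : ∀ᶠ w in 𝓝 (t : ℂ), ∀ s, γ s = Φ w → ∃ t', γ t' = γ t ∧ |s - t'| < δ :=
      (hΦt ▸ hΦc.tendsto (t : ℂ)).eventually (h.eventually_fiber_near (γ t) hδ)
    obtain ⟨ε, hε, hball⟩ := Metric.eventually_nhds_iff.1 h1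
    refine ⟨min δ (ε / 2), lt_min hδ (half_pos hε), min_le_left _ _, fun w h1 h2 => hball ?_⟩
    have := min_le_right δ (ε / 2)
    rw [dist_eq_norm]
    calc ‖w - t‖ ≤ |(w - t).re| + |(w - t).im| := Complex.norm_le_abs_re_add_abs_im _
      _ < ε := by simp; linarith
  have hoff : ∀ w : ℂ, |w.re - t| < η → |w.im| < η → w.im ≠ 0 → Φ w ∉ range γ := by
    rintro w h1 h2 h3 ⟨s, hs⟩
    obtain ⟨t', ht', hst⟩ := hηN w h1 h2 s hs
    obtain ⟨n, rfl⟩ := exists_eq_add_int ht ht'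
    have h4 : ((s - n : ℝ) : ℂ) = w := by
      refine e.injOn (hδe _ ?_ ?_) (hδe w (by linarith) (by linarith)) ?_
      · rw [Complex.ofReal_re]
        rwa [show s - n - t = s - (t + n) by ring]
      · simpa using hδ
      · change Φ _ = Φ w
        rw [← hs, ← h.apply_add_int s (-n)]
        simp [hΦ, sub_eq_add_neg]
    exact h3 (by rw [← h4, Complex.ofReal_im])
  have hconst : ∀ P : Set ℂ, Convex ℝ P → (∀ w ∈ P, |w.re - t| < η ∧ |w.im| < η ∧ w.im ≠ 0) →
      ∃ c, ∀ w ∈ P, f (Φ w) = c := by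
    intro P hP hPw
    obtain ⟨c, hc⟩ := hP.isPreconnected.exists_eq_of_eventually_const (D := univ)
      (f := fun w => f (Φ w)) (fun x _ => by rw [nhdsWithin_univ]; infer_instance)
      (fun x hx => ⟨f (Φ x), by
        rw [nhdsWithin_univ]
        obtain ⟨h1, h2, h3⟩ := hPw x hx
        exact hΦc.continuousAt.eventually (hf _ (hoff x h1 h2 h3))⟩)
    exact ⟨c, fun w hw => hc w ⟨mem_univ w, hw⟩⟩
  have hre : ∀ I : Set ℝ, Convex ℝ I → Convex ℝ {w : ℂ | w.re ∈ I} := fun I hI =>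
    hI.linear_preimage Complex.reLm
  have him : ∀ I : Set ℝ, Convex ℝ I → Convex ℝ {w : ℂ | w.im ∈ I} := fun I hI =>
    hI.linear_preimage Complex.imLm
  obtain ⟨a, ha⟩ := hconst ({w | w.re ∈ Ioo (t - η) (t + η)} ∩ {w | w.im ∈ Ioo 0 η})
    ((hre _ (convex_Ioo _ _)).inter (him _ (convex_Ioo _ _))) (fun w hw => by
      obtain ⟨⟨h1, h2⟩, h3, h4⟩ := hw
      exact ⟨abs_lt.2 ⟨by linarith, by linarith⟩, abs_lt.2 ⟨by linarith, h4⟩, h3.ne'⟩)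
  obtain ⟨b, hb⟩ := hconst ({w | w.re ∈ Ioo (t - η) (t + η)} ∩ {w | w.im ∈ Ioo (-η) 0})
    ((hre _ (convex_Ioo _ _)).inter (him _ (convex_Ioo _ _))) (fun w hw => by
      obtain ⟨⟨h1, h2⟩, h3, h4⟩ := hw
      exact ⟨abs_lt.2 ⟨by linarith, by linarith⟩, abs_lt.2 ⟨by linarith, by linarith⟩, h4.ne⟩)
  have hbox : ∀ᶠ w in 𝓝 (t : ℂ), (0 < w.im → Φ w ∉ range γ ∧ f (Φ w) = a) ∧
      (w.im < 0 → Φ w ∉ range γ ∧ f (Φ w) = b) := by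
    have h1 : ∀ᶠ w : ℂ in 𝓝 (t : ℂ), w.re ∈ Ioo (t - η) (t + η) :=
      Complex.continuous_re.continuousAt.eventually
        (Ioo_mem_nhds (by simpa using hη) (by simpa using hη))
    have h2 : ∀ᶠ w : ℂ in 𝓝 (t : ℂ), w.im ∈ Ioo (-η) η :=
      Complex.continuous_im.continuousAt.eventually
        (Ioo_mem_nhds (by simpa using hη) (by simpa using hη))
    filter_upwards [h1, h2] with w hw1 hw2
    have hw1' : |w.re - t| < η := abs_lt.2 ⟨by linarith [hw1.1], by linarith [hw1.2]⟩
    exact ⟨fun h3 => ⟨hoff w hw1' (abs_lt.2 hw2) h3.ne', ha w ⟨hw1, h3, hw2.2⟩⟩,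
      fun h3 => ⟨hoff w hw1' (abs_lt.2 hw2) h3.ne, hb w ⟨hw1, hw2.1, h3⟩⟩⟩
  refine ⟨a, b, ?_, ?_, ?_⟩
  · intro c c' x hc hcx hc'
    have hψc : HasDerivAt (fun y => ψ (c y)) (v⁻¹ * c') x := by
      have := (hcx ▸ hψd).comp x hc
      exact this
    have hu : HasDerivAt (fun y => (ψ (c y)).im) (c' / v).im x := by
      have := Complex.imCLM.hasFDerivAt.comp_hasDerivAt x hψc
      rw [div_eq_inv_mul]
      exact this
    have hev : ∀ᶠ y in 𝓝 x, Φ (ψ (c y)) = c y ∧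
        (0 < (ψ (c y)).im → Φ (ψ (c y)) ∉ range γ ∧ f (Φ (ψ (c y))) = a) ∧
        ((ψ (c y)).im < 0 → Φ (ψ (c y)) ∉ range γ ∧ f (Φ (ψ (c y))) = b) := by
      refine (Tendsto.eventually (hcx ▸ hc.continuousAt) hψ).and ?_
      refine Tendsto.eventually (f := fun y => ψ (c y)) ?_ hbox
      have := hψc.continuousAt
      rwa [ContinuousAt, hcx, hψt] at this
    obtain ⟨h1, h2⟩ := hu.eventually_sign (by rw [hcx, hψt, Complex.ofReal_im]) hc'
    constructor
    · filter_upwards [h1, hev.filter_mono nhdsWithin_le_nhds] with y hy hy'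
      rw [← hy'.1]
      exact hy'.2.1 hy
    · filter_upwards [h2, hev.filter_mono nhdsWithin_le_nhds] with y hy hy'
      rw [← hy'.1]
      exact hy'.2.2 hy
  · filter_upwards [Complex.continuous_ofReal.continuousAt.eventually
      (eventually_eventually_nhds.2 hbox)] with s hs
    have h1 : Tendsto (fun x : ℝ => (s : ℂ) + x * Complex.I) (𝓝 0) (𝓝 s) := by
      have : Continuous fun x : ℝ => (s : ℂ) + x * Complex.I := by fun_prop
      simpa using this.tendsto 0
    have h2 : Tendsto (fun x : ℝ => (s : ℂ) + (-x : ℝ) * Complex.I) (𝓝 0) (𝓝 s) := by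
      have : Continuous fun x : ℝ => (s : ℂ) + (-x : ℝ) * Complex.I := by fun_prop
      simpa using this.tendsto 0
    filter_upwards [self_mem_nhdsWithin, (h1.eventually hs).filter_mono nhdsWithin_le_nhds,
      (h2.eventually hs).filter_mono nhdsWithin_le_nhds] with x (hx0 : 0 < x) hx hx'
    simp only [hΦ, Complex.add_re, Complex.add_im, Complex.ofReal_re, Complex.ofReal_im,
      Complex.re_ofReal_mul, Complex.im_ofReal_mul, Complex.I_re, Complex.I_im, mul_zero, mul_one,
      add_zero, zero_add] at hx hx'
    exact ⟨(hx.1 hx0).2, (hx'.2 (neg_lt_zero.2 hx0)).2⟩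
  · have hψ' : Tendsto ψ (𝓝 (γ t)) (𝓝 t) := hψt ▸ hψd.continuousAt.tendsto
    filter_upwards [hψ, hψ'.eventually hbox] with z hz hz' hzγ
    rw [← hz]
    rcases lt_trichotomy (ψ z).im 0 with h0 | h0 | h0
    · exact Or.inr (hz'.2 h0).2
    · refine (hzγ ⟨(ψ z).re, ?_⟩).elim
      conv_rhs => rw [← hz]
      simp [hΦ, h0]
    · exact Or.inl (hz'.1 h0).2

end IsImmersedLoop

theorem HasSides.eventually_normal {γ : ℝ → ℂ} {f : ℂ → ℂ} {t : ℝ} {a b u : ℂ}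
    (h : HasSides γ f t a b) (hu : 0 < (u / deriv γ t).im) :
    ∀ᶠ x : ℝ in 𝓝[>] 0, f (γ t + x * u) = a ∧ f (γ t + (-x : ℝ) * u) = b := by
  have hd : HasDerivAt (fun x : ℝ => γ t + x * u) u 0 := by
    simpa using ((hasDerivAt_id (0 : ℝ)).ofReal_comp.mul_const u).const_add (γ t)
  obtain ⟨h1, h2⟩ := h _ u 0 hd (by simp) hu
  have h3 : Tendsto (fun x : ℝ => -x) (𝓝[>] 0) (𝓝[<] 0) := by
    simpa using tendsto_neg_nhdsGT (a := (0 : ℝ))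
  filter_upwards [h1, h3.eventually h2] with y hy hy' using ⟨hy.2, hy'.2⟩

theorem HasSides.eventually_normal_notMem {γ : ℝ → ℂ} {f : ℂ → ℂ} {t : ℝ} {a b u : ℂ}
    (h : HasSides γ f t a b) (hu : 0 < (u / deriv γ t).im) :
    ∀ᶠ x : ℝ in 𝓝[>] 0, γ t + x * u ∉ range γ ∧ γ t + (-x : ℝ) * u ∉ range γ := by
  have hd : HasDerivAt (fun x : ℝ => γ t + x * u) u 0 := by
    simpa using ((hasDerivAt_id (0 : ℝ)).ofReal_comp.mul_const u).const_add (γ t)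
  obtain ⟨h1, h2⟩ := h _ u 0 hd (by simp) hu
  have h3 : Tendsto (fun x : ℝ => -x) (𝓝[>] 0) (𝓝[<] 0) := by
    simpa using tendsto_neg_nhdsGT (a := (0 : ℝ))
  filter_upwards [h1, h3.eventually h2] with y hy hy' using ⟨hy.1, hy'.1⟩

namespace IsImmersedLoop

variable {γ : ℝ → ℂ} {f g : ℂ → ℂ} {s t : ℝ} {c d : ℂ}

theorem eventually_normal_of_hasJump (h : IsImmersedLoop γ) (hc : HasJump γ f t c) :
    ∀ᶠ x : ℝ in 𝓝[>] 0, f (γ t + x * (Complex.I * deriv γ t)) -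
      f (γ t + (-x : ℝ) * (Complex.I * deriv γ t)) = c := by
  obtain ⟨a, b, hab, rfl⟩ := hc
  filter_upwards [hab.eventually_normal (u := Complex.I * deriv γ t) (by
    rw [mul_div_cancel_right₀ _ (h.deriv_ne_zero t)]; simp)] with x hx
  rw [hx.1, hx.2]

theorem hasJump_unique (h : IsImmersedLoop γ) (hc : HasJump γ f t c) (hd : HasJump γ f t d) :
    c = d := by
  obtain ⟨x, h1, h2⟩ :=
    ((h.eventually_normal_of_hasJump hc).and (h.eventually_normal_of_hasJump hd)).exists
  exact h1.symm.trans h2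

theorem hasJump_add_int (h : IsImmersedLoop γ) (n : ℤ) :
    HasJump γ f (t + n) c ↔ HasJump γ f t c := by
  simp only [HasJump, HasSides, h.apply_add_int, h.deriv_add_int]

theorem exists_eventually_hasSides (h : IsImmersedLoop γ) (hf : IsLocConstOff γ f)
    (ht : t ∉ multipleParams γ) : ∃ a b, (∀ᶠ s in 𝓝 t, HasSides γ f s a b) ∧
      ∀ᶠ z in 𝓝 (γ t), z ∉ range γ → f z = a ∨ f z = b := by
  obtain ⟨a, b, -, h2, h3⟩ := h.exists_local_sides hf ht
  refine ⟨a, b, ?_, h3⟩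
  have hpos : ∀ᶠ s in 𝓝 t, 0 < (Complex.I * deriv γ t / deriv γ s).im := by
    have : ContinuousAt (fun s => (Complex.I * deriv γ t / deriv γ s).im) t :=
      Complex.continuous_im.continuousAt.comp
        (continuousAt_const.div h.continuous_deriv.continuousAt (h.deriv_ne_zero t))
    refine this.eventually (lt_mem_nhds ?_)
    beta_reduce
    rw [mul_div_cancel_right₀ _ (h.deriv_ne_zero t)]; simp
  filter_upwards [hpos, h2, h.eventually_notMem_nhds ht] with s hs1 hs2 hs3
  obtain ⟨a', b', hab, -, -⟩ := h.exists_local_sides hf hs3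
  obtain ⟨x, hx1, hx2⟩ := (hs2.and (hab.eventually_normal hs1)).exists
  rwa [← hx1.1, ← hx1.2, hx2.1, hx2.2]

theorem exists_eventually_hasJump (h : IsImmersedLoop γ) (hf : IsLocConstOff γ f)
    (ht : t ∉ multipleParams γ) : ∃ c, ∀ᶠ s in 𝓝 t, HasJump γ f s c := by
  obtain ⟨a, b, hab, -⟩ := h.exists_eventually_hasSides hf ht
  exact ⟨a - b, hab.mono fun s hs => ⟨a, b, hs, rfl⟩⟩

theorem exists_hasJump_of_preconnected (h : IsImmersedLoop γ) (hf : IsLocConstOff γ f)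
    {s : Set ℝ} (hs : IsPreconnected s) (hsT : ∀ t ∈ s, t ∉ multipleParams γ) :
    ∃ c, ∀ t ∈ s, HasJump γ f t c := by
  have h1 : ∀ t ∈ s, ∃ c, ∀ᶠ u in 𝓝 t, HasJump γ f u c := fun t ht =>
    h.exists_eventually_hasJump hf (hsT t ht)
  choose! J hJ using h1
  obtain ⟨c, hc⟩ := hs.exists_eq_of_eventually_const (D := s) (f := J)
    (fun x hx => mem_closure_iff_nhdsWithin_neBot.1 (subset_closure hx)) (fun x hx => ⟨J x, by
      filter_upwards [(hJ x hx).filter_mono nhdsWithin_le_nhds, self_mem_nhdsWithin] with y hy hys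
      exact h.hasJump_unique (hJ y hys).self_of_nhds hy⟩)
  exact ⟨c, fun t ht => hc t ⟨ht, ht⟩ ▸ (hJ t ht).self_of_nhds⟩

end IsImmersedLoop

theorem IsLocConstOff.add {γ : ℝ → ℂ} {f g : ℂ → ℂ} (hf : IsLocConstOff γ f)
    (hg : IsLocConstOff γ g) : IsLocConstOff γ (f + g) := fun z hz => by
  filter_upwards [hf z hz, hg z hz] with y h1 h2
  rw [Pi.add_apply, Pi.add_apply, h1, h2]

theorem IsLocConstOff.smul {γ : ℝ → ℂ} {f : ℂ → ℂ} (hf : IsLocConstOff γ f) (r : ℂ) :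
    IsLocConstOff γ (r • f) := fun z hz => by
  filter_upwards [hf z hz] with y h1
  rw [Pi.smul_apply, Pi.smul_apply, h1]

theorem HasJump.add {γ : ℝ → ℂ} {f g : ℂ → ℂ} {t : ℝ} {c d : ℂ} (hf : HasJump γ f t c)
    (hg : HasJump γ g t d) : HasJump γ (f + g) t (c + d) := by
  obtain ⟨a, b, h1, rfl⟩ := hf
  obtain ⟨a', b', h2, rfl⟩ := hg
  refine ⟨a + a', b + b', fun p p' x hp hx hp' => ?_, by ring⟩
  obtain ⟨h3, h4⟩ := h1 p p' x hp hx hp'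
  obtain ⟨h5, h6⟩ := h2 p p' x hp hx hp'
  constructor
  · filter_upwards [h3, h5] with y hy hy'
    exact ⟨hy.1, by rw [Pi.add_apply, hy.2, hy'.2]⟩
  · filter_upwards [h4, h6] with y hy hy'
    exact ⟨hy.1, by rw [Pi.add_apply, hy.2, hy'.2]⟩

theorem HasJump.smul {γ : ℝ → ℂ} {f : ℂ → ℂ} {t : ℝ} {c : ℂ} (hf : HasJump γ f t c) (r : ℂ) :
    HasJump γ (r • f) t (r * c) := by
  obtain ⟨a, b, h1, rfl⟩ := hf
  refine ⟨r * a, r * b, fun p p' x hp hx hp' => ?_, by ring⟩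
  obtain ⟨h3, h4⟩ := h1 p p' x hp hx hp'
  constructor
  · filter_upwards [h3] with y hy
    exact ⟨hy.1, by rw [Pi.smul_apply, hy.2, smul_eq_mul]⟩
  · filter_upwards [h4] with y hy
    exact ⟨hy.1, by rw [Pi.smul_apply, hy.2, smul_eq_mul]⟩

theorem HasSides.congr {γ : ℝ → ℂ} {f g : ℂ → ℂ} {t : ℝ} {a b : ℂ} (hf : HasSides γ f t a b)
    (hfg : EqOn f g (range γ)ᶜ) : HasSides γ g t a b := fun p p' x hp hx hp' => by
  obtain ⟨h1, h2⟩ := hf p p' x hp hx hp'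
  exact ⟨h1.mono fun y hy => ⟨hy.1, (hfg hy.1).symm.trans hy.2⟩,
    h2.mono fun y hy => ⟨hy.1, (hfg hy.1).symm.trans hy.2⟩⟩

theorem HasJump.congr {γ : ℝ → ℂ} {f g : ℂ → ℂ} {t : ℝ} {c : ℂ} (hf : HasJump γ f t c)
    (hfg : EqOn f g (range γ)ᶜ) : HasJump γ g t c := by
  obtain ⟨a, b, h1, h2⟩ := hf
  exact ⟨a, b, h1.congr hfg, h2⟩

/-- The jump of `f` along `γ` increases by `d` at the parameter `t`. -/
def HasJumpChange (γ : ℝ → ℂ) (f : ℂ → ℂ) (t : ℝ) (d : ℂ) : Prop :=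
  ∃ j₁ j₂, (∀ᶠ s in 𝓝[>] t, HasJump γ f s j₁) ∧ (∀ᶠ s in 𝓝[<] t, HasJump γ f s j₂) ∧
    j₁ - j₂ = d

theorem HasJumpChange.add {γ : ℝ → ℂ} {f g : ℂ → ℂ} {t : ℝ} {c d : ℂ}
    (hf : HasJumpChange γ f t c) (hg : HasJumpChange γ g t d) :
    HasJumpChange γ (f + g) t (c + d) := by
  obtain ⟨a, b, h1, h2, rfl⟩ := hf
  obtain ⟨a', b', h3, h4, rfl⟩ := hg
  exact ⟨a + a', b + b', (h1.and h3).mono fun s hs => hs.1.add hs.2,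
    (h2.and h4).mono fun s hs => hs.1.add hs.2, by ring⟩

theorem HasJumpChange.smul {γ : ℝ → ℂ} {f : ℂ → ℂ} {t : ℝ} {c : ℂ}
    (hf : HasJumpChange γ f t c) (r : ℂ) : HasJumpChange γ (r • f) t (r * c) := by
  obtain ⟨a, b, h1, h2, rfl⟩ := hf
  exact ⟨r * a, r * b, h1.mono fun s hs => hs.smul r, h2.mono fun s hs => hs.smul r, by ring⟩

theorem HasJumpChange.congr {γ : ℝ → ℂ} {f g : ℂ → ℂ} {t : ℝ} {c : ℂ}
    (hf : HasJumpChange γ f t c) (hfg : EqOn f g (range γ)ᶜ) : HasJumpChange γ g t c := by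
  obtain ⟨a, b, h1, h2, h3⟩ := hf
  exact ⟨a, b, h1.mono fun s hs => hs.congr hfg, h2.mono fun s hs => hs.congr hfg, h3⟩

namespace IsImmersedLoop

variable {γ : ℝ → ℂ} {f g : ℂ → ℂ} {s t : ℝ} {c d : ℂ}

theorem hasJumpChange_unique (h : IsImmersedLoop γ) (hc : HasJumpChange γ f t c)
    (hd : HasJumpChange γ f t d) : c = d := by
  obtain ⟨a, b, h1, h2, rfl⟩ := hc
  obtain ⟨a', b', h3, h4, rfl⟩ := hd
  obtain ⟨x, hx⟩ := (h1.and h3).exists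
  obtain ⟨y, hy⟩ := (h2.and h4).exists
  rw [h.hasJump_unique hx.1 hx.2, h.hasJump_unique hy.1 hy.2]

theorem exists_hasJumpChange (h : IsImmersedLoop γ) (hf : IsLocConstOff γ f) (t : ℝ) :
    ∃ d, HasJumpChange γ f t d := by
  have hT := h.eventually_notMem_nhdsNE t
  rw [← Iio_union_Ioi, nhdsWithin_union, eventually_sup] at hT
  obtain ⟨l, hl, hlT⟩ := mem_nhdsLT_iff_exists_Ioo_subset.1 hT.1
  obtain ⟨r, hr, hrT⟩ := mem_nhdsGT_iff_exists_Ioo_subset.1 hT.2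
  obtain ⟨j₁, hj₁⟩ := h.exists_hasJump_of_preconnected hf isPreconnected_Ioo hrT
  obtain ⟨j₂, hj₂⟩ := h.exists_hasJump_of_preconnected hf isPreconnected_Ioo hlT
  refine ⟨j₁ - j₂, j₁, j₂, ?_, ?_, rfl⟩
  · filter_upwards [Ioo_mem_nhdsGT hr] with s hs using hj₁ s hs
  · filter_upwards [Ioo_mem_nhdsLT hl] with s hs using hj₂ s hs

theorem hasJumpChange_add_int (h : IsImmersedLoop γ) (n : ℤ) (hd : HasJumpChange γ f t d) :
    HasJumpChange γ f (t + n) d := by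
  obtain ⟨a, b, h1, h2, rfl⟩ := hd
  refine ⟨a, b, ?_, ?_, rfl⟩
  · filter_upwards [(tendsto_sub_const_nhdsGT (add_sub_cancel_right t (n : ℝ))).eventually h1]
      with s hs
    rw [← h.hasJump_add_int n] at hs
    simpa using hs
  · filter_upwards [(tendsto_sub_const_nhdsLT (add_sub_cancel_right t (n : ℝ))).eventually h2]
      with s hs
    rw [← h.hasJump_add_int n] at hs
    simpa using hs

/-- If the jump does not change at the multiple parameters, it is constant. -/
theorem exists_hasJump_of_hasJumpChange_zero (h : IsImmersedLoop γ) (hf : IsLocConstOff γ f)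
    (h0 : ∀ t ∈ multipleParams γ ∩ Ico 0 1, HasJumpChange γ f t 0) :
    ∃ c, ∀ t ∉ multipleParams γ, HasJump γ f t c := by
  have h1 : ∀ t ∈ (multipleParams γ)ᶜ, ∃ c, ∀ᶠ u in 𝓝 t, HasJump γ f u c := fun t ht =>
    h.exists_eventually_hasJump hf ht
  choose! J hJ using h1
  obtain ⟨c, hc⟩ := (isPreconnected_univ (α := ℝ)).exists_eq_of_eventually_const
    (D := (multipleParams γ)ᶜ) (f := J)
    (fun x _ => mem_closure_iff_nhdsWithin_neBot.1 (h.dense_compl_multipleParams x)) (by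
      intro t _
      by_cases ht : t ∈ multipleParams γ
      · have h2 := h0 (Int.fract t)
          ⟨h.fract_mem_multipleParams.2 ht, Int.fract_nonneg t, Int.fract_lt_one t⟩
        have h3 := h.hasJumpChange_add_int ⌊t⌋ h2
        rw [Int.fract_add_floor] at h3
        obtain ⟨a, b, h4, h5, h6⟩ := h3
        obtain rfl := sub_eq_zero.1 h6
        have h7 := eventually_sup.2 ⟨h5, h4⟩
        rw [← nhdsWithin_union, Iio_union_Ioi] at h7
        refine ⟨a, ?_⟩
        filter_upwards [self_mem_nhdsWithin, h7.filter_mono (nhdsWithin_mono t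
          fun y (hy : y ∉ multipleParams γ) (hyt : y = t) => hy (hyt ▸ ht))] with s hs hs'
        exact h.hasJump_unique (hJ s hs).self_of_nhds hs'
      · refine ⟨J t, ?_⟩
        filter_upwards [(hJ t ht).filter_mono nhdsWithin_le_nhds, self_mem_nhdsWithin] with y hy hys
        exact h.hasJump_unique (hJ y hys).self_of_nhds hy)
  exact ⟨c, fun t ht => hc t ⟨ht, mem_univ t⟩ ▸ (hJ t ht).self_of_nhds⟩

theorem finite_image_multipleParams (h : IsImmersedLoop γ) : (γ '' multipleParams γ).Finite := by
  refine (h.finite_multipleParams.image γ).subset ?_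
  rintro _ ⟨t, ht, rfl⟩
  exact ⟨Int.fract t, ⟨h.fract_mem_multipleParams.2 ht, Int.fract_nonneg t, Int.fract_lt_one t⟩,
    h.apply_fract t⟩

/-- A locally constant function without jumps is constant. -/
theorem exists_eq_const_of_hasJump_zero (h : IsImmersedLoop γ) (hf : IsLocConstOff γ f)
    (h0 : ∀ t ∉ multipleParams γ, HasJump γ f t 0) : ∃ c, ∀ z ∉ range γ, f z = c := by
  have hconn : IsPreconnected (γ '' multipleParams γ)ᶜ :=
    (h.finite_image_multipleParams.countable.isConnected_compl_of_one_lt_rank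
      (by rw [Complex.rank_real_complex]; norm_num)).isPreconnected
  have hdense : Dense (range γ)ᶜ :=
    h.contDiff.dense_compl_range_of_finrank_lt_finrank (by simp [Complex.finrank_real_complex])
  obtain ⟨c, hc⟩ := hconn.exists_eq_of_eventually_const (D := (range γ)ᶜ) (f := f)
    (fun x _ => mem_closure_iff_nhdsWithin_neBot.1 (hdense x)) (by
      intro z hz
      by_cases hzγ : z ∈ range γ
      · obtain ⟨t, rfl⟩ := hzγ
        have ht : t ∉ multipleParams γ := fun ht => hz ⟨t, ht, rfl⟩
        obtain ⟨a, b, h1, h2⟩ := h.exists_eventually_hasSides hf ht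
        have hab : a = b := sub_eq_zero.1
          (h.hasJump_unique ⟨a, b, h1.self_of_nhds, rfl⟩ (h0 t ht))
        refine ⟨a, ?_⟩
        rw [eventually_nhdsWithin_iff]
        filter_upwards [h2] with z hz hzγ
        rcases hz hzγ with h3 | h3
        exacts [h3, h3.trans hab.symm]
      · exact ⟨f z, (hf z hzγ).filter_mono nhdsWithin_le_nhds⟩)
  refine ⟨c, fun z hz => hc z ⟨hz, fun hz' => hz (image_subset_range _ _ hz')⟩⟩

end IsImmersedLoop

theorem Complex.log_sub_log_neg_of_im_pos {z : ℂ} (hz : 0 < z.im) :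
    Complex.log z - Complex.log (-z) = Real.pi * Complex.I := by
  rw [Complex.log, Complex.log, norm_neg, Complex.arg_neg_eq_arg_sub_pi_of_im_pos hz]
  push_cast
  ring

theorem Complex.log_sub_log_neg_of_im_neg {z : ℂ} (hz : z.im < 0) :
    Complex.log z - Complex.log (-z) = -(Real.pi * Complex.I) := by
  have := Complex.log_sub_log_neg_of_im_pos (z := -z) (by simpa using hz)
  rw [neg_neg] at this
  rw [← this, neg_sub]

/-- `2πi` times the total winding of the arc of `γ` from `a` to `b` around `z`. -/
noncomputable def arcWinding (γ : ℝ → ℂ) (a b : ℝ) (z : ℂ) : ℂ :=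
  ∫ s in a..b, deriv γ s / (γ s - z)

namespace IsImmersedLoop

variable {γ : ℝ → ℂ} {a b t : ℝ} {p q : ℂ}

theorem intervalIntegrable_arcWinding (h : IsImmersedLoop γ) (hp : ∀ s ∈ uIcc a b, γ s ≠ p) :
    IntervalIntegrable (fun s => deriv γ s / (γ s - p)) MeasureTheory.volume a b :=
  (h.continuous_deriv.continuousOn.div (h.continuous.sub continuous_const).continuousOn
    fun s hs => sub_ne_zero.2 (hp s hs)).intervalIntegrable

theorem arcWinding_eq_log_sub_log (h : IsImmersedLoop γ) {u : ℂ}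
    (hu : u ≠ 0) (hs : ∀ s ∈ uIcc a b, u * (γ s - p) ∈ Complex.slitPlane) :
    arcWinding γ a b p = Complex.log (u * (γ b - p)) - Complex.log (u * (γ a - p)) := by
  refine intervalIntegral.integral_eq_sub_of_hasDerivAt
    (f := fun s => Complex.log (u * (γ s - p))) (fun s hs' => ?_)
    (h.intervalIntegrable_arcWinding fun s hs' h0 => ?_)
  · have := (((h.hasDerivAt s).sub_const p).const_mul u).clog_real (hs s hs')
    rwa [mul_div_mul_left _ _ hu] at this
  · exact Complex.slitPlane_ne_zero (hs s hs') (by rw [h0, sub_self, mul_zero])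

theorem arcWinding_sub_arcWinding (h : IsImmersedLoop γ)
    (hs : ∀ s ∈ uIcc a b, ‖q - p‖ < ‖γ s - q‖) :
    arcWinding γ a b p - arcWinding γ a b q =
      Complex.log ((γ b - p) / (γ b - q)) - Complex.log ((γ a - p) / (γ a - q)) := by
  have hq : ∀ s ∈ uIcc a b, γ s - q ≠ 0 := fun s h1 =>
    norm_pos_iff.1 ((norm_nonneg _).trans_lt (hs s h1))
  have hp : ∀ s ∈ uIcc a b, γ s - p ≠ 0 := fun s h1 h0 => by
    have := hs s h1
    rw [← sub_eq_zero.1 h0, norm_sub_rev] at this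
    exact this.false
  rw [arcWinding, arcWinding, ← intervalIntegral.integral_sub
    (h.intervalIntegrable_arcWinding fun s h1 => sub_ne_zero.1 (hp s h1))
    (h.intervalIntegrable_arcWinding fun s h1 => sub_ne_zero.1 (hq s h1))]
  refine intervalIntegral.integral_eq_sub_of_hasDerivAt
    (f := fun s => Complex.log ((γ s - p) / (γ s - q))) (fun s h1 => ?_) ?_
  · have h2 : (γ s - p) / (γ s - q) ∈ Complex.slitPlane := by
      have h3 : (γ s - p) / (γ s - q) = 1 + (q - p) / (γ s - q) := by
        have := hq s h1
        field_simp
        ring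
      rw [h3]
      apply Complex.mem_slitPlane_of_norm_lt_one
      rw [norm_div]
      exact (div_lt_one (norm_pos_iff.2 (hq s h1))).2 (hs s h1)
    have h4 := (((h.hasDerivAt s).sub_const p).div ((h.hasDerivAt s).sub_const q)
      (hq s h1)).clog_real h2
    refine h4.congr_deriv ?_
    have := hq s h1
    have := hp s h1
    simp only [Pi.div_apply]
    field_simp
  · exact (h.intervalIntegrable_arcWinding fun s h1 => sub_ne_zero.1 (hp s h1)).sub
      (h.intervalIntegrable_arcWinding fun s h1 => sub_ne_zero.1 (hq s h1))

theorem eventually_norm_sub_lt (h : IsImmersedLoop γ) (hq : ∀ s ∈ uIcc a b, γ s ≠ q) :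
    ∀ᶠ p in 𝓝 q, ∀ s ∈ uIcc a b, ‖q - p‖ < ‖γ s - q‖ := by
  have hK : IsClosed (γ '' uIcc a b) := (isCompact_uIcc.image h.continuous).isClosed
  obtain ⟨ε, hε, hb⟩ := Metric.isOpen_iff.1 hK.isOpen_compl q
    (by rintro ⟨s, hs, h1⟩; exact hq s hs h1)
  filter_upwards [Metric.ball_mem_nhds q hε] with p hp s hs
  rw [← dist_eq_norm, dist_comm]
  refine (Metric.mem_ball.1 hp).trans_le ?_
  by_contra! h1
  exact hb (by rwa [Metric.mem_ball, dist_eq_norm]) ⟨s, hs, rfl⟩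

theorem continuousAt_arcWinding (h : IsImmersedLoop γ) (hq : ∀ s ∈ uIcc a b, γ s ≠ q) :
    ContinuousAt (arcWinding γ a b) q := by
  have h1 : ∀ s ∈ uIcc a b, ContinuousAt (fun p => Complex.log ((γ s - p) / (γ s - q))) q :=
    fun s hs => by
      have h0 : γ s - q ≠ 0 := sub_ne_zero.2 (hq s hs)
      refine ((continuousAt_const.sub continuousAt_id).div_const _).clog ?_
      simp [div_self h0]
  have h2 : ContinuousAt (fun p => arcWinding γ a b q +
      (Complex.log ((γ b - p) / (γ b - q)) - Complex.log ((γ a - p) / (γ a - q)))) q :=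
    continuousAt_const.add ((h1 b right_mem_uIcc).sub (h1 a left_mem_uIcc))
  refine h2.congr ?_
  filter_upwards [h.eventually_norm_sub_lt hq] with p hp
  rw [← h.arcWinding_sub_arcWinding hp]
  ring

theorem isLocConstOff_arcWinding (h : IsImmersedLoop γ) (hab : γ a = γ b) :
    IsLocConstOff γ (arcWinding γ a b) := fun z hz => by
  filter_upwards [h.eventually_norm_sub_lt (a := a) (b := b) (q := z)
    fun s _ hs => hz ⟨s, hs⟩] with y hy
  have := h.arcWinding_sub_arcWinding hy
  rwa [hab, sub_self, sub_eq_zero] at this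

theorem arcWinding_add (h : IsImmersedLoop γ) {c : ℝ} (hab : ∀ s ∈ uIcc a b, γ s ≠ p)
    (hbc : ∀ s ∈ uIcc b c, γ s ≠ p) :
    arcWinding γ a b p + arcWinding γ b c p = arcWinding γ a c p :=
  intervalIntegral.integral_add_adjacent_intervals (h.intervalIntegrable_arcWinding hab)
    (h.intervalIntegrable_arcWinding hbc)

theorem tendsto_normal (γ : ℝ → ℂ) (t : ℝ) (u : ℂ) :
    Tendsto (fun x : ℝ => γ t + x * u) (𝓝[>] 0) (𝓝 (γ t)) ∧
      Tendsto (fun x : ℝ => γ t + (-x : ℝ) * u) (𝓝[>] 0) (𝓝 (γ t)) := by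
  constructor
  · have : ContinuousAt (fun x : ℝ => γ t + x * u) 0 := by fun_prop
    simpa [ContinuousAt] using this.tendsto.mono_left (nhdsWithin_le_nhds (s := Ioi 0))
  · have : ContinuousAt (fun x : ℝ => γ t + (-x : ℝ) * u) 0 := by fun_prop
    simpa [ContinuousAt] using this.tendsto.mono_left (nhdsWithin_le_nhds (s := Ioi 0))

theorem tendsto_arcWinding_normal_sub (h : IsImmersedLoop γ) (t : ℝ) {δ₀ : ℝ} (hδ₀ : 0 < δ₀) :
    ∃ δ, 0 < δ ∧ δ < δ₀ ∧ Tendsto (fun x : ℝ =>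
      arcWinding γ (t - δ) (t + δ) (γ t + x * (Complex.I * deriv γ t)) -
      arcWinding γ (t - δ) (t + δ) (γ t + (-x : ℝ) * (Complex.I * deriv γ t)))
      (𝓝[>] 0) (𝓝 (2 * Real.pi * Complex.I)) := by
  set v := deriv γ t with hv
  have hv0 : v ≠ 0 := h.deriv_ne_zero t
  set w : ℝ → ℂ := fun s => (γ s - γ t) / v with hw
  have hwd : HasDerivAt (fun s => (w s).re) 1 t := by
    have h1 : HasDerivAt w 1 t := by
      have := ((h.hasDerivAt t).sub_const (γ t)).div_const v
      rwa [← hv, div_self hv0] at this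
    exact Complex.reCLM.hasFDerivAt.comp_hasDerivAt t h1
  obtain ⟨h1, h2⟩ := hwd.eventually_sign (by simp [hw]) one_pos
  rw [eventually_nhdsWithin_iff] at h1 h2
  obtain ⟨ε, hε, hb⟩ := Metric.eventually_nhds_iff.1 (h1.and h2)
  set δ := min (ε / 2) (δ₀ / 2) with hδ
  have hδ0 : 0 < δ := by positivity
  have hδε : δ < ε := (min_le_left _ _).trans_lt (half_lt_self hε)
  refine ⟨δ, hδ0, (min_le_right _ _).trans_lt (half_lt_self hδ₀), ?_⟩
  have hsl : ∀ s ∈ uIcc (t - δ) (t + δ), ∀ x : ℝ, 0 < x → 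
      Complex.I * w s + x ∈ Complex.slitPlane ∧ -(Complex.I * w s) + x ∈ Complex.slitPlane := by
    intro s hs x hx
    rw [uIcc_of_le (by linarith)] at hs
    have hd : dist s t < ε := by
      rw [Real.dist_eq]
      exact (abs_le.2 ⟨by linarith [hs.1], by linarith [hs.2]⟩ : |s - t| ≤ δ).trans_lt hδε
    rcases lt_trichotomy s t with hst | rfl | hst
    · have := ((hb hd).2 hst).ne
      exact ⟨Or.inr (by simpa using this), Or.inr (by simpa using this)⟩
    · simp [hw, Complex.mem_slitPlane_iff, hx]
    · have := ((hb hd).1 hst).ne'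
      exact ⟨Or.inr (by simpa using this), Or.inr (by simpa using this)⟩
  have e1 : ∀ (s x : ℝ), Complex.I / v * (γ s - (γ t + x * (Complex.I * v)))
      = Complex.I * w s + x := fun s x => by
    simp only [hw]
    field_simp
    linear_combination (-x * v) * Complex.I_sq
  have e2 : ∀ (s x : ℝ), -Complex.I / v * (γ s - (γ t + (-x : ℝ) * (Complex.I * v)))
      = -(Complex.I * w s) + x := fun s x => by
    simp only [hw]
    push_cast
    field_simp
    linear_combination (-x * v) * Complex.I_sq
  have hp : 0 < (Complex.I * w (t + δ)).im := by
    have := (hb (y := t + δ) (by simpa [abs_of_pos hδ0] using hδε)).1 (by simpa using hδ0)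
    simpa using this
  have hn : (Complex.I * w (t - δ)).im < 0 := by
    have := (hb (y := t - δ) (by simpa [Real.dist_eq, abs_of_pos hδ0] using hδε)).2
      (by simpa using hδ0)
    simpa using this
  have hlim : ∀ u : ℂ, u.im ≠ 0 →
      Tendsto (fun x : ℝ => Complex.log (u + x)) (𝓝[>] 0) (𝓝 (Complex.log u)) := fun u hu => by
    have : ContinuousAt (fun x : ℝ => Complex.log (u + x)) 0 := by
      refine ContinuousAt.clog (by fun_prop) (Or.inr (by simpa using hu))
    simpa [ContinuousAt] using this.tendsto.mono_left (nhdsWithin_le_nhds (s := Ioi 0))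
  have hL := ((hlim _ hp.ne').sub (hlim _ hn.ne)).sub
    ((hlim (-(Complex.I * w (t + δ))) (by simpa using hp.ne')).sub
      (hlim (-(Complex.I * w (t - δ))) (by simpa using hn.ne)))
  have hval : Complex.log (Complex.I * w (t + δ)) - Complex.log (Complex.I * w (t - δ)) -
      (Complex.log (-(Complex.I * w (t + δ))) - Complex.log (-(Complex.I * w (t - δ)))) =
      2 * Real.pi * Complex.I := by
    linear_combination Complex.log_sub_log_neg_of_im_pos hp -
      Complex.log_sub_log_neg_of_im_neg hn
  rw [hval] at hL
  refine hL.congr' ?_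
  filter_upwards [self_mem_nhdsWithin] with x (hx : 0 < x)
  rw [h.arcWinding_eq_log_sub_log (u := Complex.I / v) (div_ne_zero Complex.I_ne_zero hv0)
    fun s hs => by rw [e1]; exact (hsl s hs x hx).1,
    h.arcWinding_eq_log_sub_log (u := -Complex.I / v)
      (div_ne_zero (neg_ne_zero.2 Complex.I_ne_zero) hv0)
    fun s hs => by rw [e2]; exact (hsl s hs x hx).2, e1, e1, e2, e2]

theorem hasJump_arcWinding_of_notMem (h : IsImmersedLoop γ) (hab : γ a = γ b)
    (ht : t ∉ multipleParams γ) (hs : ∀ s ∈ uIcc a b, γ s ≠ γ t) :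
    HasJump γ (arcWinding γ a b) t 0 := by
  obtain ⟨c, hc⟩ := h.exists_eventually_hasJump (h.isLocConstOff_arcWinding hab) ht
  have hc := hc.self_of_nhds
  obtain ⟨h1, h2⟩ := tendsto_normal γ t (Complex.I * deriv γ t)
  have h3 := h.continuousAt_arcWinding hs
  have h4 := (h3.tendsto.comp h1).sub (h3.tendsto.comp h2)
  rw [sub_self] at h4
  have h5 := h4.congr' (h.eventually_normal_of_hasJump hc)
  rwa [tendsto_nhds_unique h5 tendsto_const_nhds]

theorem hasJump_arcWinding (h : IsImmersedLoop γ) (hab : γ a = γ b) (hb : b ≤ a + 1)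
    (ht : t ∉ multipleParams γ) (htab : t ∈ Ioo a b) :
    HasJump γ (arcWinding γ a b) t (2 * Real.pi * Complex.I) := by
  obtain ⟨c, hc⟩ := h.exists_eventually_hasJump (h.isLocConstOff_arcWinding hab) ht
  have hc := hc.self_of_nhds
  obtain ⟨δ, hδ, hδ', hL⟩ := h.tendsto_arcWinding_normal_sub t (δ₀ := min (t - a) (b - t))
    (lt_min (sub_pos.2 htab.1) (sub_pos.2 htab.2))
  obtain ⟨hδa, hδb⟩ := lt_min_iff.1 hδ'
  obtain ⟨h1, h2⟩ := tendsto_normal γ t (Complex.I * deriv γ t)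
  have hne : ∀ s, a ≤ s → s ≤ b → γ s = γ t → s = t := fun s hs1 hs2 hst => by
    obtain ⟨n, rfl⟩ := exists_eq_add_int ht hst
    have h3 : ((-1 : ℤ) : ℝ) < n := by push_cast; linarith [htab.2]
    have h4 : (n : ℝ) < (1 : ℤ) := by push_cast; linarith [htab.1]
    have : n = 0 := by
      have := Int.cast_lt.1 h3
      have := Int.cast_lt.1 h4
      omega
    simp [this]
  have hA : ∀ s ∈ uIcc a (t - δ), γ s ≠ γ t := fun s hs hst => by
    rw [uIcc_of_le (by linarith)] at hs
    have := hne s hs.1 (by linarith [hs.2]) hst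
    linarith [hs.2]
  have hB : ∀ s ∈ uIcc (t + δ) b, γ s ≠ γ t := fun s hs hst => by
    rw [uIcc_of_le (by linarith)] at hs
    have := hne s (by linarith [hs.1]) hs.2 hst
    linarith [hs.1]
  have h3 := h.continuousAt_arcWinding hA
  have h4 := h.continuousAt_arcWinding hB
  have h5 := (((h3.tendsto.comp h1).sub (h3.tendsto.comp h2)).add hL).add
    ((h4.tendsto.comp h1).sub (h4.tendsto.comp h2))
  rw [sub_self, sub_self, zero_add, add_zero] at h5
  have hI : (0 : ℝ) < (Complex.I * deriv γ t / deriv γ t).im := by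
    rw [mul_div_cancel_right₀ _ (h.deriv_ne_zero t)]; simp
  have hoff : ∀ᶠ x : ℝ in 𝓝[>] 0, γ t + x * (Complex.I * deriv γ t) ∉ range γ ∧
      γ t + (-x : ℝ) * (Complex.I * deriv γ t) ∉ range γ := by
    obtain ⟨c₁, c₂, hcs, -⟩ := hc
    exact hcs.eventually_normal_notMem hI
  have h6 : Tendsto (fun _ : ℝ => c) (𝓝[>] (0 : ℝ)) (𝓝 (2 * Real.pi * Complex.I)) := by
    refine h5.congr' ?_
    filter_upwards [h.eventually_normal_of_hasJump hc, hoff] with x hx hx'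
    have key : ∀ q ∉ range γ, arcWinding γ a b q = arcWinding γ a (t - δ) q +
        arcWinding γ (t - δ) (t + δ) q + arcWinding γ (t + δ) b q := fun q hq => by
      have hq' : ∀ u v : ℝ, ∀ s ∈ uIcc u v, γ s ≠ q := fun u v s _ hs => hq ⟨s, hs⟩
      rw [h.arcWinding_add (hq' _ _) (hq' _ _), h.arcWinding_add (hq' _ _) (hq' _ _)]
    rw [← hx, key _ hx'.1, key _ hx'.2]
    simp only [Function.comp]
    ring
  rwa [tendsto_nhds_unique tendsto_const_nhds h6] at hc

end IsImmersedLoop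

namespace IsImmersedLoop

variable {γ : ℝ → ℂ} {a b t : ℝ}

theorem hasJump_arcWinding_outside (h : IsImmersedLoop γ) (hab : γ a = γ b) (hab' : a ≤ b)
    (ht : t ∉ multipleParams γ) (hbt : b < t) (hta : t < a + 1) :
    HasJump γ (arcWinding γ a b) t 0 := by
  refine h.hasJump_arcWinding_of_notMem hab ht fun s hs hst => ?_
  rw [uIcc_of_le hab'] at hs
  obtain ⟨n, rfl⟩ := exists_eq_add_int ht hst
  have h3 : ((-1 : ℤ) : ℝ) < n := by push_cast; linarith [hs.1]
  have h4 : (n : ℝ) < (0 : ℤ) := by push_cast; linarith [hs.2]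
  have := Int.cast_lt.1 h3
  have := Int.cast_lt.1 h4
  omega

theorem hasJumpChange_of_eventually (h : IsImmersedLoop γ) {f : ℂ → ℂ} {c d : ℂ}
    (h1 : ∀ᶠ s in 𝓝[>] t, s ∉ multipleParams γ → HasJump γ f s c)
    (h2 : ∀ᶠ s in 𝓝[<] t, s ∉ multipleParams γ → HasJump γ f s d) :
    HasJumpChange γ f t (c - d) := by
  have h3 := h.eventually_notMem_nhdsNE t
  refine ⟨c, d, ?_, ?_, rfl⟩
  · filter_upwards [h1, h3.filter_mono (nhdsWithin_mono t fun y (hy : t < y) => hy.ne')]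
      with s hs hs' using hs hs'
  · filter_upwards [h2, h3.filter_mono (nhdsWithin_mono t fun y (hy : y < t) => hy.ne)]
      with s hs hs' using hs hs'

theorem hasJumpChange_arcWinding (h : IsImmersedLoop γ) (hab : γ a = γ b) (ha : 0 ≤ a)
    (hlt : a < b) (hb : b < 1) (ht : t ∈ Ico (0 : ℝ) 1) :
    HasJumpChange γ (arcWinding γ a b) t
      (2 * Real.pi * Complex.I * ((if t = a then 1 else 0) - if t = b then 1 else 0)) := by
  have hin : ∀ s, a < s → s < b → s ∉ multipleParams γ →
      HasJump γ (arcWinding γ a b) s (2 * Real.pi * Complex.I) := fun s h1 h2 hs =>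
    h.hasJump_arcWinding hab (by linarith) hs ⟨h1, h2⟩
  have hout : ∀ s, b < s → s < a + 1 → s ∉ multipleParams γ →
      HasJump γ (arcWinding γ a b) s 0 := fun s h1 h2 hs =>
    h.hasJump_arcWinding_outside hab hlt.le hs h1 h2
  have hout' : ∀ s, b - 1 < s → s < a → s ∉ multipleParams γ →
      HasJump γ (arcWinding γ a b) s 0 := fun s h1 h2 hs => by
    have := hout (s + (1 : ℤ)) (by push_cast; linarith) (by push_cast; linarith)
      ((h.add_int_mem_multipleParams 1).not.2 hs)
    exact (h.hasJump_add_int 1).1 this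
  rcases lt_trichotomy t a with hta | rfl | hta
  · rw [if_neg hta.ne, if_neg (hta.trans hlt).ne, sub_self, mul_zero, ← sub_zero (0 : ℂ)]
    have hN : ∀ᶠ s in 𝓝 t, s ∉ multipleParams γ → HasJump γ (arcWinding γ a b) s 0 := by
      filter_upwards [lt_mem_nhds (show b - 1 < t by linarith [ht.1]), gt_mem_nhds hta] with s h1 h2
        using hout' s h1 h2
    exact h.hasJumpChange_of_eventually (hN.filter_mono nhdsWithin_le_nhds)
      (hN.filter_mono nhdsWithin_le_nhds)
  · rw [if_pos rfl, if_neg hlt.ne, sub_zero, mul_one, ← sub_zero (2 * Real.pi * Complex.I)]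
    refine h.hasJumpChange_of_eventually ?_ ?_
    · filter_upwards [Ioo_mem_nhdsGT hlt] with s hs using hin s hs.1 hs.2
    · filter_upwards [Ioo_mem_nhdsLT (show b - 1 < t by linarith)] with s hs using hout' s hs.1 hs.2
  rw [if_neg hta.ne']
  rcases lt_trichotomy t b with htb | rfl | htb
  · rw [if_neg htb.ne, sub_self, mul_zero, ← sub_self (2 * Real.pi * Complex.I)]
    have hN : ∀ᶠ s in 𝓝 t, s ∉ multipleParams γ →
        HasJump γ (arcWinding γ a b) s (2 * Real.pi * Complex.I) := by
      filter_upwards [lt_mem_nhds hta, gt_mem_nhds htb] with s h1 h2 using hin s h1 h2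
    exact h.hasJumpChange_of_eventually (hN.filter_mono nhdsWithin_le_nhds)
      (hN.filter_mono nhdsWithin_le_nhds)
  · rw [if_pos rfl, show 2 * Real.pi * Complex.I * (0 - 1) = 0 - 2 * Real.pi * Complex.I by ring]
    refine h.hasJumpChange_of_eventually ?_ ?_
    · filter_upwards [Ioo_mem_nhdsGT (show t < a + 1 by linarith)] with s hs using hout s hs.1 hs.2
    · filter_upwards [Ioo_mem_nhdsLT hta] with s hs using hin s hs.1 hs.2
  · rw [if_neg htb.ne', sub_self, mul_zero, ← sub_zero (0 : ℂ)]
    have hN : ∀ᶠ s in 𝓝 t, s ∉ multipleParams γ → HasJump γ (arcWinding γ a b) s 0 := by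
      filter_upwards [lt_mem_nhds htb, gt_mem_nhds (show t < a + 1 by linarith [ht.2])]
        with s h1 h2 using hout s h1 h2
    exact h.hasJumpChange_of_eventually (hN.filter_mono nhdsWithin_le_nhds)
      (hN.filter_mono nhdsWithin_le_nhds)

theorem apply_zero_eq_apply_one (h : IsImmersedLoop γ) : γ 0 = γ 1 := by
  simpa using (h.apply_add_int 0 1).symm

theorem hasJump_arcWinding_zero_one (h : IsImmersedLoop γ) (ht : t ∉ multipleParams γ) :
    HasJump γ (arcWinding γ 0 1) t (2 * Real.pi * Complex.I) := by
  have key : ∀ s ∈ Ioo (0 : ℝ) 1, s ∉ multipleParams γ →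
      HasJump γ (arcWinding γ 0 1) s (2 * Real.pi * Complex.I) := fun s hs hsT =>
    h.hasJump_arcWinding h.apply_zero_eq_apply_one (by simp) hsT hs
  have hfr : Int.fract t ∉ multipleParams γ := h.fract_mem_multipleParams.not.2 ht
  suffices HasJump γ (arcWinding γ 0 1) (Int.fract t) (2 * Real.pi * Complex.I) by
    rwa [← Int.fract_add_floor t, h.hasJump_add_int]
  rcases (Int.fract_nonneg t).eq_or_lt with h0 | h0
  · rw [← h0] at hfr ⊢
    obtain ⟨c, hc⟩ := h.exists_eventually_hasJump
      (h.isLocConstOff_arcWinding h.apply_zero_eq_apply_one) hfr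
    obtain ⟨s, ⟨h1, h2⟩, h3⟩ := (((hc.and (h.eventually_notMem_nhds hfr)).filter_mono
      nhdsWithin_le_nhds).and (Ioo_mem_nhdsGT (zero_lt_one (α := ℝ)))).exists
    rw [h.hasJump_unique (key s h3 h2) h1]
    exact hc.self_of_nhds
  · exact key _ ⟨h0, Int.fract_lt_one t⟩ hfr

end IsImmersedLoop

namespace IsImmersedLoop

variable {γ : ℝ → ℂ} {f : ℂ → ℂ} {t : ℝ}

theorem eventually_re_pos (h : IsImmersedLoop γ) (t : ℝ) :
    ∀ᶠ u in 𝓝[≠] (0 : ℝ), γ (t + u) ≠ γ t ∧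
      0 < u * (deriv γ (t + u) / (γ (t + u) - γ t)).re := by
  have h1 := (h.hasDerivAt t).tendsto_slope_zero
  have h2 : Tendsto (fun u => deriv γ (t + u)) (𝓝[≠] 0) (𝓝 (deriv γ t)) := by
    have : ContinuousAt (fun u => deriv γ (t + u)) 0 :=
      (h.continuous_deriv.comp (continuous_const.add continuous_id)).continuousAt
    simpa [ContinuousAt] using this.tendsto.mono_left (nhdsWithin_le_nhds (s := {0}ᶜ))
  have h3 := Complex.continuous_re.continuousAt.tendsto.comp (h2.div h1 (h.deriv_ne_zero t))
  rw [div_self (h.deriv_ne_zero t), Complex.one_re] at h3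
  filter_upwards [h3.eventually (lt_mem_nhds one_pos), self_mem_nhdsWithin] with u hu (hu0 : u ≠ 0)
  have h4 : u * (deriv γ (t + u) / (γ (t + u) - γ t)).re =
      (deriv γ (t + u) / (u⁻¹ • (γ (t + u) - γ t))).re := by
    rw [Complex.real_smul, ← Complex.re_ofReal_mul]
    congr 1
    push_cast
    rw [div_mul_eq_div_div, div_inv_eq_mul]
    ring
  rw [h4]
  refine ⟨fun h5 => ?_, hu⟩
  simp [h5] at hu

theorem strictMonoOn_norm (h : IsImmersedLoop γ) {σ δ : ℝ} {p : ℂ}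
    (hσ : ∀ x, 0 < x → x ≤ δ → γ (t + σ * x) ≠ p ∧
      0 < σ * (deriv γ (t + σ * x) / (γ (t + σ * x) - p)).re) :
    StrictMonoOn (fun x => ‖γ (t + σ * x) - p‖) (Icc 0 δ) := by
  have hd : ∀ x, HasDerivAt (fun x => γ (t + σ * x) - p) (σ * deriv γ (t + σ * x)) x := fun x => by
    have := (h.hasDerivAt (t + σ * x)).scomp x
      (((hasDerivAt_id x).const_mul σ).const_add t)
    simpa using this.sub_const p
  have hsq : StrictMonoOn (fun x => ‖γ (t + σ * x) - p‖ ^ 2) (Icc 0 δ) := by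
    refine strictMonoOn_of_deriv_pos (convex_Icc 0 δ) ?_ fun x hx => ?_
    · exact (((h.continuous.comp (by fun_prop)).sub continuous_const).norm.pow 2).continuousOn
    · rw [interior_Icc] at hx
      obtain ⟨h1, h2⟩ := hσ x hx.1 hx.2.le
      rw [((hd x).norm_sq).deriv, Complex.inner]
      have h3 := sub_ne_zero.2 h1
      have h4 : 0 < Complex.normSq (γ (t + σ * x) - p) := Complex.normSq_pos.2 h3
      have h5 : σ * deriv γ (t + σ * x) * (starRingEnd ℂ) (γ (t + σ * x) - p) =
          ((σ * Complex.normSq (γ (t + σ * x) - p) : ℝ) : ℂ) *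
            (deriv γ (t + σ * x) / (γ (t + σ * x) - p)) := by
        push_cast
        rw [Complex.normSq_eq_conj_mul_self]
        field_simp
      have h6 : 0 < (σ * deriv γ (t + σ * x) * (starRingEnd ℂ) (γ (t + σ * x) - p)).re := by
        rw [h5, Complex.re_ofReal_mul, mul_comm σ, mul_assoc]
        exact mul_pos h4 h2
      exact mul_pos two_pos h6
  exact fun x hx y hy hxy => lt_of_pow_lt_pow_left₀ 2 (norm_nonneg _) (hsq hx hy hxy)

theorem exists_norm_eq (h : IsImmersedLoop γ) {σ δ r : ℝ} (hδ : 0 < δ) (hr : 0 < r)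
    (hr' : r ≤ ‖γ (t + σ * δ) - γ t‖) : ∃ x, 0 < x ∧ x ≤ δ ∧ ‖γ (t + σ * x) - γ t‖ = r := by
  have hc : ContinuousOn (fun x => ‖γ (t + σ * x) - γ t‖) (Icc 0 δ) :=
    ((h.continuous.comp (by fun_prop)).sub continuous_const).norm.continuousOn
  obtain ⟨x, hx, hxr⟩ := intermediate_value_Icc hδ.le hc (show r ∈ Icc _ _ by simp [hr.le, hr'])
  refine ⟨x, hx.1.lt_of_ne ?_, hx.2, hxr⟩
  rintro rfl
  simp only [mul_zero, add_zero, sub_self, norm_zero] at hxr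
  exact hr.ne hxr

end IsImmersedLoop

/-- The values of `f` along a small circle around `p`, near a point where it crosses `γ`. -/
theorem HasJump.eventually_circle {γ : ℝ → ℂ} {f : ℂ → ℂ} {t : ℝ} {p c : ℂ}
    {σ r x : ℝ} (hc : HasJump γ f t c) (hσ : σ = 1 ∨ σ = -1)
    (hre : 0 < σ * (deriv γ t / (γ t - p)).re)
    (hx : p + r * Complex.exp (2 * Real.pi * Complex.I * x) = γ t) :
    ∃ a b, a - b = σ * c ∧
      (∀ᶠ y : ℝ in 𝓝[>] x, f (p + r * Complex.exp (2 * Real.pi * Complex.I * y)) = a) ∧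
      ∀ᶠ y : ℝ in 𝓝[<] x, f (p + r * Complex.exp (2 * Real.pi * Complex.I * y)) = b := by
  obtain ⟨a, b, hab, rfl⟩ := hc
  have hd : ∀ κ : ℝ, HasDerivAt (fun y : ℝ => p + r * Complex.exp (2 * Real.pi * Complex.I *
      (κ * y : ℝ))) (κ * (2 * Real.pi * Complex.I) *
        (r * Complex.exp (2 * Real.pi * Complex.I * (κ * (κ * x) : ℝ)))) (κ * x) := fun κ => by
    have h1 : HasDerivAt (fun y : ℝ => 2 * Real.pi * Complex.I * (κ * y : ℝ))
        (2 * Real.pi * Complex.I * κ) (κ * x) := by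
      simpa using (((hasDerivAt_id (κ * x)).const_mul κ).ofReal_comp).const_mul
        (2 * Real.pi * Complex.I)
    refine ((h1.cexp.const_mul (r : ℂ)).const_add p).congr_deriv ?_
    ring
  have hx' : (r : ℂ) * Complex.exp (2 * Real.pi * Complex.I * x) = γ t - p :=
    eq_sub_of_add_eq' hx
  have him : 0 < (σ * (2 * Real.pi * Complex.I) * (γ t - p) / deriv γ t).im := by
    have h1 : σ * (2 * Real.pi * Complex.I) * (γ t - p) / deriv γ t =
        ((2 * Real.pi : ℝ) : ℂ) * (((σ : ℂ) * (deriv γ t / (γ t - p))⁻¹) * Complex.I) := by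
      rw [inv_div]
      push_cast
      ring
    rw [h1, Complex.im_ofReal_mul, Complex.mul_I_im, Complex.re_ofReal_mul, Complex.inv_re,
      ← mul_div_assoc]
    refine mul_pos (by positivity) (div_pos hre (Complex.normSq_pos.2 fun h0 => ?_))
    simp [h0] at hre
  have hσσ : σ * (σ * x) = x := by rcases hσ with rfl | rfl <;> ring
  have key := hab _ _ _ (hd σ) (by rw [hσσ]; exact hx) (by rwa [hσσ, hx'])
  rcases hσ with rfl | rfl
  · refine ⟨a, b, by simp, ?_, ?_⟩
    · simpa using key.1.mono fun y hy => hy.2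
    · simpa using key.2.mono fun y hy => hy.2
  · refine ⟨b, a, by push_cast; ring, ?_, ?_⟩
    · have h1 : Tendsto (fun y : ℝ => -y) (𝓝[>] x) (𝓝[<] (-1 * x)) := by
        rw [neg_one_mul]; exact tendsto_neg_nhdsGT
      filter_upwards [h1.eventually key.2] with y hy
      simpa using hy.2
    · have h1 : Tendsto (fun y : ℝ => -y) (𝓝[<] x) (𝓝[>] (-1 * x)) := by
        rw [neg_one_mul]; exact tendsto_neg_nhdsLT
      filter_upwards [h1.eventually key.1] with y hy
      simpa using hy.2

namespace IsImmersedLoop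

variable {γ : ℝ → ℂ} {f : ℂ → ℂ} {t : ℝ}

/-- The jump changes of a locally constant function at the passages through a point sum to `0`. -/
theorem sum_jumpChange_eq_zero (h : IsImmersedLoop γ) (hf : IsLocConstOff γ f) {p : ℂ}
    {F : Finset ℝ} (hF : ∀ t, t ∈ F ↔ t ∈ Ico (0 : ℝ) 1 ∧ γ t = p) {d : ℝ → ℂ}
    (hd : ∀ t ∈ F, HasJumpChange γ f t (d t)) : ∑ t ∈ F, d t = 0 := by
  choose! j₁ j₂ hj₁ hj₂ hj using hd
  obtain ⟨δ, hδ, hloc⟩ : ∃ δ, 0 < δ ∧ ∀ u, u ≠ 0 → |u| ≤ δ → ∀ t ∈ F,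
      t + u ∉ multipleParams γ ∧ γ (t + u) ≠ p ∧
        0 < u * (deriv γ (t + u) / (γ (t + u) - p)).re ∧
        (0 < u → HasJump γ f (t + u) (j₁ t)) ∧ (u < 0 → HasJump γ f (t + u) (j₂ t)) := by
    have h1 : ∀ᶠ u in 𝓝[≠] (0 : ℝ), ∀ t ∈ F, t + u ∉ multipleParams γ ∧ γ (t + u) ≠ p ∧
        0 < u * (deriv γ (t + u) / (γ (t + u) - p)).re ∧
        (0 < u → HasJump γ f (t + u) (j₁ t)) ∧ (u < 0 → HasJump γ f (t + u) (j₂ t)) := by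
      refine (Filter.eventually_all_finset F).2 fun t ht => ?_
      have hc : Tendsto (fun u : ℝ => t + u) (𝓝 0) (𝓝 t) := by
        have : Continuous fun u : ℝ => t + u := by fun_prop
        simpa using this.tendsto 0
      have a1 := hc.eventually (eventually_nhdsWithin_iff.1 (h.eventually_notMem_nhdsNE t))
      have a2 := hc.eventually (eventually_nhdsWithin_iff.1 (hj₁ t ht))
      have a3 := hc.eventually (eventually_nhdsWithin_iff.1 (hj₂ t ht))
      have a4 := h.eventually_re_pos t
      rw [((hF t).1 ht).2] at a4
      filter_upwards [a1.filter_mono nhdsWithin_le_nhds, a2.filter_mono nhdsWithin_le_nhds,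
        a3.filter_mono nhdsWithin_le_nhds, a4, self_mem_nhdsWithin] with u u1 u2 u3 u4 (u5 : u ≠ 0)
      exact ⟨u1 (by simpa using u5), u4.1, u4.2, fun hu => u2 (by simpa using hu),
        fun hu => u3 (by simpa using hu)⟩
    obtain ⟨ε, hε, hb⟩ := Metric.eventually_nhds_iff.1 (eventually_nhdsWithin_iff.1 h1)
    exact ⟨ε / 2, half_pos hε, fun u hu hu' =>
      hb (by rw [Real.dist_eq, sub_zero]; exact hu'.trans_lt (half_lt_self hε)) hu⟩
  let σ : Bool → ℝ := fun b => if b then 1 else -1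
  have hσ : ∀ b, σ b = 1 ∨ σ b = -1 := fun b => by cases b <;> simp [σ]
  have hσabs : ∀ b, |σ b| = 1 := fun b => by cases b <;> simp [σ]
  have hrad : ∀ t ∈ F, ∀ b x, 0 < x → x ≤ δ → γ (t + σ b * x) ≠ p ∧
      0 < σ b * (deriv γ (t + σ b * x) / (γ (t + σ b * x) - p)).re := by
    intro t ht b x hx hxδ
    have hne : σ b * x ≠ 0 := mul_ne_zero (by rcases hσ b with h1 | h1 <;> simp [h1]) hx.ne'
    obtain ⟨-, h2, h3, -⟩ := hloc (σ b * x) hne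
      (by rw [abs_mul, hσabs, one_mul, abs_of_pos hx]; exact hxδ) t ht
    refine ⟨h2, ?_⟩
    rw [mul_right_comm] at h3
    exact pos_of_mul_pos_left h3 hx.le
  obtain ⟨R, hR, hfib⟩ := Metric.eventually_nhds_iff.1 (h.eventually_fiber_near p hδ)
  obtain ⟨r, ⟨hr, hrR⟩, hrN⟩ : ∃ r, (0 < r ∧ r < R) ∧
      ∀ t ∈ F, ∀ b, r ≤ ‖γ (t + σ b * δ) - p‖ := by
    have h1 : ∀ᶠ r in 𝓝[>] (0 : ℝ), ∀ t ∈ F, ∀ b, r ≤ ‖γ (t + σ b * δ) - p‖ := by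
      refine (Filter.eventually_all_finset F).2 fun t ht => eventually_all.2 fun b => ?_
      exact ((gt_mem_nhds (norm_pos_iff.2 (sub_ne_zero.2 (hrad t ht b δ hδ le_rfl).1))).filter_mono
        nhdsWithin_le_nhds).mono fun r hr => hr.le
    exact (Eventually.and (Ioo_mem_nhdsGT hR) h1).exists
  have hcross : ∀ i : F × Bool, ∃ x, 0 < x ∧ x ≤ δ ∧ ‖γ (i.1 + σ i.2 * x) - p‖ = r := fun i => by
    have := h.exists_norm_eq (t := i.1) (σ := σ i.2) hδ hr
    rw [((hF _).1 i.1.2).2] at this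
    exact this (hrN _ i.1.2 _)
  choose X hX0 hXδ hXr using hcross
  set τ : F × Bool → ℝ := fun i => i.1 + σ i.2 * X i with hτ
  set C : ℝ → ℂ := fun y => p + r * Complex.exp (2 * Real.pi * Complex.I * y) with hC
  have hCper : Periodic C 1 := fun y => by
    simp only [hC]
    push_cast
    rw [mul_add, mul_one, Complex.exp_add, Complex.exp_two_pi_mul_I, mul_one]
  have hCinj : ∀ y z, C y = C z → ∃ n : ℤ, y = z + n := fun y z hyz => by
    have h1 := mul_left_cancel₀ (Complex.ofReal_ne_zero.2 hr.ne') (add_left_cancel hyz)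
    obtain ⟨n, hn⟩ := Complex.exp_eq_exp_iff_exists_int.1 h1
    refine ⟨n, ?_⟩
    have h2 : 2 * Real.pi * Complex.I * (y - (z + n)) = 0 := by linear_combination hn
    have h3 := (mul_eq_zero.1 h2).resolve_left Complex.two_pi_I_ne_zero
    exact_mod_cast sub_eq_zero.1 h3
  have hCnorm : ∀ y, ‖C y - p‖ = r := fun y => by
    have : (2 * Real.pi * Complex.I * y : ℂ) = ((2 * Real.pi * y : ℝ) : ℂ) * Complex.I := by
      push_cast; ring
    simp only [hC]
    rw [add_sub_cancel_left, norm_mul, this, Complex.norm_exp_ofReal_mul_I, mul_one,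
      Complex.norm_real, Real.norm_of_nonneg hr.le]
  have hCcont : Continuous C := by fun_prop
  have hθ : ∀ i, ∃ y : ℝ, C y = γ (τ i) := fun i => by
    refine ⟨(γ (τ i) - p).arg / (2 * Real.pi), ?_⟩
    have h1 : (2 * Real.pi * Complex.I * (((γ (τ i) - p).arg / (2 * Real.pi) : ℝ) : ℂ)) =
        (γ (τ i) - p).arg * Complex.I := by
      have : (Real.pi : ℂ) ≠ 0 := Complex.ofReal_ne_zero.2 Real.pi_ne_zero
      push_cast
      field_simp
    simp only [hC]
    rw [h1, ← hXr i, Complex.norm_mul_exp_arg_mul_I, add_sub_cancel]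
  choose θ hθ using hθ
  have hτT : ∀ i, τ i ∉ multipleParams γ ∧ HasJump γ f (τ i)
      (if i.2 then j₁ i.1 else j₂ i.1) := fun i => by
    have hne : σ i.2 * X i ≠ 0 :=
      mul_ne_zero (by rcases hσ i.2 with h1 | h1 <;> simp [h1]) (hX0 i).ne'
    obtain ⟨h1, -, -, h2, h3⟩ := hloc (σ i.2 * X i) hne
      (by rw [abs_mul, hσabs, one_mul, abs_of_pos (hX0 i)]; exact hXδ i) i.1 i.1.2
    refine ⟨h1, ?_⟩
    obtain ⟨t, b⟩ := i
    cases b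
    · exact h3 (by simpa [σ] using hX0 (t, false))
    · exact h2 (by simpa [σ] using hX0 (t, true))
  have hdist : ∀ i j (n : ℤ), θ i = θ j + n → i = j := by
    have hbase : ∀ i j : F × Bool, ∀ m : ℤ, i.2 = j.2 → τ i = τ j + m → X i ≤ X j → i.1 = j.1 := by
      intro i j m hij hm hle
      rcases hle.eq_or_lt with heq | hlt
      · have h1 : (i.1 : ℝ) = j.1 + m := by
          simp only [hτ, hij, heq] at hm
          linarith
        have h2 := congrArg Int.fract h1
        rw [Int.fract_add_intCast, Int.fract_eq_self.2 ((hF _).1 i.1.2).1,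
          Int.fract_eq_self.2 ((hF _).1 j.1.2).1] at h2
        exact Subtype.ext h2
      · exfalso
        refine (hrad j.1 j.1.2 j.2 (X j - X i) (sub_pos.2 hlt)
          ((sub_le_self _ (hX0 i).le).trans (hXδ j))).1 ?_
        have h1 : (j.1 : ℝ) + σ j.2 * (X j - X i) = i.1 + (-m : ℤ) := by
          simp only [hτ, hij] at hm
          push_cast
          linarith
        rw [h1, h.apply_add_int, ((hF _).1 i.1.2).2]
    intro i j n hij
    have h1 : γ (τ i) = γ (τ j) := by
      rw [← hθ, ← hθ, hij]
      simpa using hCper.int_mul n (θ j)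
    obtain ⟨m, hm⟩ := exists_eq_add_int (hτT j).1 h1
    have hre : ∀ i : F × Bool, 0 < σ i.2 * (deriv γ (τ i) / (γ (τ i) - p)).re := fun i =>
      (hrad i.1 i.1.2 i.2 (X i) (hX0 i) (hXδ i)).2
    have hb : i.2 = j.2 := by
      have h2 := hre i
      have h3 := hre j
      rw [hm, h.deriv_add_int, h.apply_add_int] at h2
      rcases hi : i.2 <;> rcases hj : j.2 <;> simp [σ, hi, hj] at h2 h3 ⊢ <;> linarith
    refine Prod.ext ?_ hb
    rcases le_total (X i) (X j) with hle | hle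
    · exact hbase i j m hb hm hle
    · exact (hbase j i (-m) hb.symm (by rw [hm]; push_cast; ring) hle).symm
  have hmain := Periodic.sum_jumps_eq_zero (g := f ∘ C) (hCper.comp f) θ
    (fun i => σ i.2 * if i.2 then j₁ i.1 else j₂ i.1) hdist ?_ ?_
  · rw [Fintype.sum_prod_type] at hmain
    rw [← Finset.sum_coe_sort]
    rw [← hmain]
    refine Finset.sum_congr rfl fun t _ => ?_
    rw [← hj t t.2]
    simp [σ, sub_eq_add_neg]
  · intro y hy
    refine (hCcont.tendsto y).eventually (hf (C y) ?_)
    rintro ⟨s, hs⟩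
    have hCR : dist (C y) p < R := by rwa [dist_eq_norm, hCnorm]
    obtain ⟨t', ht', hst⟩ := hfib hCR s hs
    have htF : Int.fract t' ∈ F :=
      (hF _).2 ⟨⟨Int.fract_nonneg _, Int.fract_lt_one _⟩, by rw [h.apply_fract, ht']⟩
    have hs0 : s - t' ≠ 0 := fun h0 => by
      have := hCnorm y
      rw [← hs, sub_eq_zero.1 h0, ht', sub_self, norm_zero] at this
      exact hr.ne this
    obtain ⟨b, hb⟩ : ∃ b, s - t' = σ b * |s - t'| := by
      rcases hs0.lt_or_gt with h1 | h1
      · exact ⟨false, by simp [σ, abs_of_neg h1]⟩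
      · exact ⟨true, by simp [σ, abs_of_pos h1]⟩
    have hγ : γ (Int.fract t' + σ b * |s - t'|) = γ s := by
      rw [← hb, ← h.apply_add_int _ ⌊t'⌋]
      congr 1
      linarith [Int.fract_add_floor t']
    let i : F × Bool := (⟨Int.fract t', htF⟩, b)
    have hX : |s - t'| = X i := by
      refine (h.strictMonoOn_norm (hrad _ htF b)).injOn ⟨abs_nonneg _, hst.le⟩
        ⟨(hX0 i).le, hXδ i⟩ ?_
      rw [hγ, hs, hCnorm]
      exact (hXr i).symm
    obtain ⟨n, hn⟩ := hCinj y (θ i) (by rw [hθ, ← hs, ← hγ, hX])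
    exact hy i n hn
  · intro i
    exact (hτT i).2.eventually_circle (hσ i.2)
      (hrad i.1 i.1.2 i.2 (X i) (hX0 i) (hXδ i)).2 (hθ i)

end IsImmersedLoop

theorem Submodule.finrank_add_card_of_sum_fiber_eq_zero {K ι κ : Type*} [Field K] [Fintype ι]
    [Fintype κ] [DecidableEq ι] [DecidableEq κ] {π : ι → κ} (hπ : Surjective π)
    (R : Submodule K (ι → K)) (h0 : ∀ u ∈ R, ∀ p, ∑ i with π i = p, u i = 0)
    (h1 : ∀ i j, π i = π j → Pi.single i 1 - Pi.single j 1 ∈ R) :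
    Module.finrank K R + Fintype.card κ = Fintype.card ι := by
  let P : (ι → K) →ₗ[K] (κ → K) := LinearMap.pi fun p => ∑ i with π i = p, LinearMap.proj i
  have hP : ∀ u p, P u p = ∑ i with π i = p, u i := fun u p => by simp [P]
  obtain ⟨r, hr⟩ := hπ.hasRightInverse
  have hker : LinearMap.ker P = R := by
    refine le_antisymm (fun u hu => ?_) fun u hu => ?_
    · have h2 : ∑ i, u i • (Pi.single (r (π i)) 1 : ι → K) = 0 := by
        rw [← Finset.sum_fiberwise Finset.univ π]
        refine Finset.sum_eq_zero fun p _ => ?_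
        have h3 : ∑ i with π i = p, u i • (Pi.single (r (π i)) 1 : ι → K) =
            (∑ i with π i = p, u i) • (Pi.single (r p) 1 : ι → K) := by
          rw [Finset.sum_smul]
          refine Finset.sum_congr rfl fun i hi => ?_
          rw [(Finset.mem_filter.1 hi).2]
        rw [h3, ← hP, LinearMap.mem_ker.1 hu, Pi.zero_apply, zero_smul]
      have h4 : u = ∑ i, u i • (Pi.single i 1 - Pi.single (r (π i)) 1 : ι → K) := by
        simp only [smul_sub, Finset.sum_sub_distrib, h2, sub_zero]
        exact pi_eq_sum_univ' u
      rw [h4]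
      exact R.sum_mem fun i _ => R.smul_mem _ (h1 _ _ (hr _).symm)
    · exact LinearMap.mem_ker.2 (funext fun p => by rw [hP, h0 u hu, Pi.zero_apply])
  have hsurj : Surjective P := fun v => by
    refine ⟨∑ p, v p • Pi.single (r p) 1, funext fun q => ?_⟩
    rw [hP]
    simp only [Finset.sum_apply, Pi.smul_apply, Pi.single_apply, smul_eq_mul, mul_ite, mul_one,
      mul_zero]
    rw [Finset.sum_comm]
    simp [Finset.sum_ite_eq', hr _]
  have := P.finrank_range_add_finrank_ker
  rw [hker, LinearMap.range_eq_top.2 hsurj, finrank_top, Module.finrank_fintype_fun_eq_card,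
    Module.finrank_fintype_fun_eq_card] at this
  omega

/-- Functions which are locally constant off the curve, extended by `0` to the curve. -/
def locConstOff (γ : ℝ → ℂ) : Submodule ℂ (ℂ → ℂ) where
  carrier := {f | IsLocConstOff γ f ∧ ∀ z ∈ range γ, f z = 0}
  add_mem' hf hg := ⟨hf.1.add hg.1, fun z hz => by simp [hf.2 z hz, hg.2 z hz]⟩
  zero_mem' := ⟨fun _ _ => by simp, fun _ _ => rfl⟩
  smul_mem' r f hf := ⟨hf.1.smul r, fun z hz => by simp [hf.2 z hz]⟩

namespace IsImmersedLoop

variable {γ : ℝ → ℂ} {f : ℂ → ℂ} {t : ℝ}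

theorem indicator_mem_locConstOff (h : IsImmersedLoop γ) (hf : IsLocConstOff γ f) :
    (range γ)ᶜ.indicator f ∈ locConstOff γ := by
  refine ⟨fun z hz => ?_, fun z hz => indicator_of_notMem (not_not.2 hz) _⟩
  filter_upwards [hf z hz, h.isCompact_range.isClosed.isOpen_compl.mem_nhds hz] with y h1 h2
  rw [indicator_of_mem h2, indicator_of_mem hz, h1]

theorem eqOn_indicator (γ : ℝ → ℂ) (f : ℂ → ℂ) :
    EqOn f ((range γ)ᶜ.indicator f) (range γ)ᶜ :=
  fun _ hz => (indicator_of_mem hz _).symm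

theorem exists_jumpChange_linearMap (h : IsImmersedLoop γ) :
    ∃ D : locConstOff γ →ₗ[ℂ] (↥(multipleParams γ ∩ Ico 0 1) → ℂ),
      ∀ (f : locConstOff γ) (i : ↥(multipleParams γ ∩ Ico 0 1)), HasJumpChange γ f i (D f i) := by
  choose D hD using fun (f : locConstOff γ) (i : ↥(multipleParams γ ∩ Ico 0 1)) =>
    h.exists_hasJumpChange f.2.1 (i : ℝ)
  refine ⟨⟨⟨D, fun f g => funext fun i => ?_⟩, fun r f => funext fun i => ?_⟩, hD⟩
  · exact h.hasJumpChange_unique (hD (f + g) i) ((hD f i).add (hD g i))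
  · exact h.hasJumpChange_unique (hD (r • f) i) ((hD f i).smul r)

theorem compl_range_nonempty (h : IsImmersedLoop γ) : (range γ)ᶜ.Nonempty := by
  by_contra hcon
  rw [not_nonempty_iff_eq_empty, compl_empty_iff] at hcon
  exact noncompact_univ ℂ (hcon ▸ h.isCompact_range)

theorem finrank_ker_jumpChange (h : IsImmersedLoop γ)
    {D : locConstOff γ →ₗ[ℂ] (↥(multipleParams γ ∩ Ico 0 1) → ℂ)}
    (hD : ∀ (f : locConstOff γ) (i : ↥(multipleParams γ ∩ Ico 0 1)),
      HasJumpChange γ f i (D f i)) :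
    Module.Finite ℂ (LinearMap.ker D) ∧ Module.finrank ℂ (LinearMap.ker D) = 2 := by
  let e₁ : locConstOff γ := ⟨(range γ)ᶜ.indicator 1,
    h.indicator_mem_locConstOff fun _ _ => by simp⟩
  let e₂ : locConstOff γ := ⟨(range γ)ᶜ.indicator ((2 * Real.pi * Complex.I)⁻¹ • arcWinding γ 0 1),
    h.indicator_mem_locConstOff ((h.isLocConstOff_arcWinding h.apply_zero_eq_apply_one).smul _)⟩
  have hj₂ : ∀ t ∉ multipleParams γ, HasJump γ e₂ t 1 := fun t ht => by
    have := ((h.hasJump_arcWinding_zero_one ht).smul (2 * Real.pi * Complex.I)⁻¹).congr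
      (eqOn_indicator γ _)
    rwa [inv_mul_cancel₀ Complex.two_pi_I_ne_zero] at this
  have hj₁ : ∀ t ∉ multipleParams γ, HasJump γ e₁ t 0 := fun t ht => by
    obtain ⟨c, hc⟩ := h.exists_eventually_hasJump e₂.2.1 ht
    have h1 := (hc.self_of_nhds.smul 0)
    rw [zero_mul] at h1
    obtain ⟨a, b, hab, -⟩ := h1
    refine ⟨1, 1, fun p p' x hp hx hp' => ?_, sub_self 1⟩
    obtain ⟨h3, h4⟩ := hab p p' x hp hx hp'
    exact ⟨h3.mono fun y hy => ⟨hy.1, indicator_of_mem hy.1 _⟩,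
      h4.mono fun y hy => ⟨hy.1, indicator_of_mem hy.1 _⟩⟩
  let Φ : (Fin 2 → ℂ) →ₗ[ℂ] locConstOff γ := Fintype.linearCombination ℂ ![e₁, e₂]
  have hΦ : ∀ v, Φ v = v 0 • e₁ + v 1 • e₂ := fun v => by
    simp [Φ, Fintype.linearCombination_apply]
  have hΦj : ∀ v, ∀ t ∉ multipleParams γ, HasJump γ (Φ v : ℂ → ℂ) t (v 1) := fun v t ht => by
    rw [hΦ]
    simpa using ((hj₁ t ht).smul (v 0)).add ((hj₂ t ht).smul (v 1))
  have hinj : Injective Φ := by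
    rw [← LinearMap.ker_eq_bot, LinearMap.ker_eq_bot']
    intro v hv
    obtain ⟨t, ht⟩ := h.dense_compl_multipleParams.nonempty
    have h1 : v 1 = 0 := by
      have h2 := hΦj v t ht
      rw [hv] at h2
      have h3 := h2.smul 0
      rw [zero_mul] at h3
      exact h.hasJump_unique h2 (by simpa using h3)
    have h0 : v 0 = 0 := by
      obtain ⟨z, hz⟩ := h.compl_range_nonempty
      have h2 := congrArg (fun f : locConstOff γ => (f : ℂ → ℂ) z) hv
      rw [hΦ, h1, zero_smul, add_zero] at h2
      simpa [e₁, indicator_of_mem hz] using h2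
    ext i
    fin_cases i
    · exact h0
    · exact h1
  have hrange : LinearMap.range Φ = LinearMap.ker D := by
    refine le_antisymm ?_ fun f hf => ?_
    · rintro _ ⟨v, rfl⟩
      refine LinearMap.mem_ker.2 (funext fun i => ?_)
      refine h.hasJumpChange_unique (hD (Φ v) i) ?_
      have := h.hasJumpChange_of_eventually (t := i)
        (Eventually.of_forall fun s hs => hΦj v s hs) (Eventually.of_forall fun s hs => hΦj v s hs)
      rwa [sub_self] at this
    · obtain ⟨c, hc⟩ := h.exists_hasJump_of_hasJumpChange_zero f.2.1 fun t ht => by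
        have := hD f ⟨t, ht⟩
        rwa [LinearMap.mem_ker.1 hf] at this
      obtain ⟨c', hc'⟩ := h.exists_eq_const_of_hasJump_zero (f - c • e₂ : locConstOff γ).2.1
        fun t ht => by
          have := (hc t ht).add ((hj₂ t ht).smul (-c))
          rw [mul_one, add_neg_cancel] at this
          simpa [sub_eq_add_neg] using this
      refine ⟨![c', c], ?_⟩
      rw [hΦ]
      ext z
      by_cases hz : z ∈ range γ
      · rw [f.2.2 z hz]
        exact (_ : locConstOff γ).2.2 z hz
      · have := hc' z hz
        have h1 : (e₁ : ℂ → ℂ) z = 1 := indicator_of_mem hz _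
        simp at this ⊢
        rw [h1, mul_one, ← this]
        ring
  rw [← hrange]
  exact ⟨inferInstance, by rw [LinearMap.finrank_range_of_inj hinj]; simp⟩

theorem finrank_locConstOff (h : IsImmersedLoop γ) : Module.Finite ℂ (locConstOff γ) ∧
    Module.finrank ℂ (locConstOff γ) + (γ '' (multipleParams γ ∩ Ico 0 1)).ncard =
      (multipleParams γ ∩ Ico 0 1).ncard + 2 := by
  classical
  obtain ⟨D, hD⟩ := h.exists_jumpChange_linearMap
  obtain ⟨hfin, hker⟩ := h.finrank_ker_jumpChange hD
  have := h.finite_multipleParams.fintype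
  have := (h.finite_multipleParams.image γ).fintype
  have hV : Module.Finite ℂ (locConstOff γ) := by
    rw [← Module.rank_lt_aleph0_iff, ← LinearMap.rank_range_add_rank_ker D]
    exact Cardinal.add_lt_aleph0 (Module.rank_lt_aleph0 _ _) (Module.rank_lt_aleph0 _ _)
  refine ⟨hV, ?_⟩
  have hrange := Submodule.finrank_add_card_of_sum_fiber_eq_zero
    (K := ℂ) (π := imageFactorization γ (multipleParams γ ∩ Ico 0 1))
    imageFactorization_surjective (LinearMap.range D) ?_ ?_
  · have h2 := D.finrank_range_add_finrank_ker
    rw [Set.ncard_eq_toFinset_card', Set.ncard_eq_toFinset_card', toFinset_card, toFinset_card]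
    omega
  · rintro _ ⟨f, rfl⟩ ⟨p, t₀, ht₀, rfl⟩
    have hmem : ∀ t, t ∈ Ico (0 : ℝ) 1 → γ t = γ t₀ → t ∈ multipleParams γ := by
      intro t ht htt
      by_contra hcon
      obtain ⟨n, hn⟩ := exists_eq_add_int hcon htt.symm
      rw [hn] at ht₀
      exact hcon ((h.add_int_mem_multipleParams n).1 ht₀.1)
    let F : Finset ℝ := ((Finset.univ.filter fun i : ↥(multipleParams γ ∩ Ico 0 1) =>
      imageFactorization γ _ i = ⟨γ t₀, t₀, ht₀, rfl⟩).map (Embedding.subtype _))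
    let d : ℝ → ℂ := fun t => if ht : t ∈ multipleParams γ ∩ Ico 0 1 then D f ⟨t, ht⟩ else 0
    have hF : ∀ t, t ∈ F ↔ t ∈ Ico (0 : ℝ) 1 ∧ γ t = γ t₀ := fun t => by
      simp only [F, Finset.mem_map, Finset.mem_filter, Finset.mem_univ, true_and]
      constructor
      · rintro ⟨i, hi, rfl⟩
        exact ⟨i.2.2, congrArg Subtype.val hi⟩
      · rintro ⟨h1, h2⟩
        exact ⟨⟨t, hmem t h1 h2, h1⟩, Subtype.ext h2, rfl⟩
    have h3 := h.sum_jumpChange_eq_zero f.2.1 hF (d := d) fun t ht => by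
      have h4 : t ∈ multipleParams γ ∩ Ico 0 1 :=
        ⟨hmem t ((hF t).1 ht).1 ((hF t).1 ht).2, ((hF t).1 ht).1⟩
      simp only [d, dif_pos h4]
      exact hD f ⟨t, h4⟩
    rw [Finset.sum_map] at h3
    rw [← h3]
    refine Finset.sum_congr rfl fun i _ => ?_
    rw [Embedding.subtype_apply]
    simp only [d]
    rw [dif_pos i.2]
  · have key : ∀ i j : ↥(multipleParams γ ∩ Ico 0 1), γ i = γ j → (i : ℝ) < j →
        Pi.single i 1 - Pi.single j 1 ∈ LinearMap.range D := fun i j hij hlt => by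
      refine ⟨⟨_, h.indicator_mem_locConstOff
        ((h.isLocConstOff_arcWinding hij).smul (2 * Real.pi * Complex.I)⁻¹)⟩, funext fun t => ?_⟩
      refine h.hasJumpChange_unique (hD _ t) ?_
      have := ((h.hasJumpChange_arcWinding hij i.2.2.1 hlt j.2.2.2 t.2.2).smul
        (2 * Real.pi * Complex.I)⁻¹).congr (eqOn_indicator γ _)
      rw [inv_mul_cancel_left₀ Complex.two_pi_I_ne_zero] at this
      simpa [Pi.single_apply, Subtype.ext_iff] using this
    intro i j hij
    have hij' : γ i = γ j := congrArg Subtype.val hij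
    rcases lt_trichotomy (i : ℝ) j with hlt | heq | hlt
    · exact key i j hij' hlt
    · rw [Subtype.ext heq, sub_self]
      exact zero_mem _
    · rw [← neg_sub]
      exact neg_mem (key j i hij'.symm hlt)

end IsImmersedLoop

theorem Complex.isPreconnected_setOf_lt_norm {R : ℝ} (hR : 0 < R) :
    IsPreconnected {z : ℂ | R < ‖z‖} := by
  have h1 : {z : ℂ | R < ‖z‖} = Complex.exp '' {w | Real.log R < w.re} := by
    ext z
    simp only [mem_ofPred_eq, mem_image]
    constructor
    · intro hz
      refine ⟨Complex.log z, ?_, Complex.exp_log (norm_pos_iff.1 (hR.trans hz))⟩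
      rw [Complex.log_re]
      exact Real.log_lt_log hR hz
    · rintro ⟨w, hw, rfl⟩
      rw [Complex.norm_exp]
      exact (Real.log_lt_iff_lt_exp hR).1 hw
  rw [h1]
  exact (convex_halfSpace_re_gt _).isPreconnected.image _ Complex.continuous_exp.continuousOn

/-- The set of connected components of the subset `F`. -/
def componentsIn {X : Type*} [TopologicalSpace X] (F : Set X) : Set (Set X) :=
  {C | ∃ x ∈ F, C = connectedComponentIn F x}

theorem ncard_componentsIn_compl_eq {K : Set ℂ} (hK : IsCompact K)
    (hfin : (componentsIn Kᶜ).Finite) :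
    (componentsIn Kᶜ).ncard = {C | C ∈ componentsIn Kᶜ ∧ IsBounded C}.ncard + 1 := by
  obtain ⟨R, hR, hKR⟩ := hK.isBounded.exists_pos_norm_le
  set A : Set ℂ := {z | R < ‖z‖} with hA
  have hAK : A ⊆ Kᶜ := fun z hz hzK => (hKR z hzK).not_gt hz
  have hAb : ¬ IsBounded A := fun hb => NormedSpace.unbounded_univ ℝ ℂ
    ((hb.union (Metric.isBounded_closedBall (x := (0 : ℂ)) (r := R))).subset fun z _ => by
      rcases lt_or_ge R ‖z‖ with h1 | h1
      · exact Or.inl h1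
      · exact Or.inr (by simpa using h1))
  obtain ⟨x, hx⟩ : A.Nonempty := by
    by_contra! h0
    exact hAb (h0 ▸ isBounded_empty)
  have hAU : A ⊆ connectedComponentIn Kᶜ x :=
    (Complex.isPreconnected_setOf_lt_norm hR).subset_connectedComponentIn hx hAK
  have hU : connectedComponentIn Kᶜ x ∈ componentsIn Kᶜ := ⟨x, hAK hx, rfl⟩
  have hset : {C | C ∈ componentsIn Kᶜ ∧ IsBounded C} =
      componentsIn Kᶜ \ {connectedComponentIn Kᶜ x} := by
    ext C
    constructor
    · rintro ⟨h1, h2⟩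
      exact ⟨h1, fun h3 => hAb ((h3 ▸ h2 : IsBounded (connectedComponentIn Kᶜ x)).subset hAU)⟩
    · rintro ⟨⟨y, hy, rfl⟩, h2⟩
      refine ⟨⟨y, hy, rfl⟩, (Metric.isBounded_closedBall (x := (0 : ℂ)) (r := R)).subset
        fun z hz => ?_⟩
      by_contra h3
      have h4 : z ∈ A := by simpa [hA] using h3
      exact h2 ((connectedComponentIn_eq hz).trans (connectedComponentIn_eq (hAU h4)).symm)
  rw [hset, ncard_sdiff_singleton_add_one hU hfin]

/-- Functions which are locally constant off the curve correspond to functions on the set of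
connected components of its complement. -/
theorem exists_linearEquiv_locConstOff {γ : ℝ → ℂ} (hγ : IsClosed (range γ)) :
    Nonempty ((↥(componentsIn (range γ)ᶜ) → ℂ) ≃ₗ[ℂ] locConstOff γ) := by
  classical
  let π : ∀ z ∉ range γ, ↥(componentsIn (range γ)ᶜ) := fun z hz =>
    ⟨connectedComponentIn (range γ)ᶜ z, z, hz, rfl⟩
  have hloc : ∀ z (hz : z ∉ range γ), ∀ᶠ y in 𝓝 z, ∃ hy : y ∉ range γ, π y hy = π z hz :=
    fun z hz => by
      filter_upwards [hγ.isOpen_compl.connectedComponentIn.mem_nhds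
        (mem_connectedComponentIn (F := (range γ)ᶜ) hz)] with y hy
      exact ⟨connectedComponentIn_subset _ _ hy, Subtype.ext (connectedComponentIn_eq hy).symm⟩
  let E : (↥(componentsIn (range γ)ᶜ) → ℂ) →ₗ[ℂ] locConstOff γ :=
    { toFun := fun u => ⟨fun z => if hz : z ∉ range γ then u (π z hz) else 0, fun z hz => by
          filter_upwards [hloc z hz] with y ⟨hy, hyz⟩
          rw [dif_pos hy, dif_pos hz, hyz], fun z hz => dif_neg (not_not.2 hz)⟩
      map_add' := fun u v => Subtype.ext (funext fun z => by
        simp only [Submodule.coe_add, Pi.add_apply]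
        split_ifs
        · rw [add_zero]
        · rfl)
      map_smul' := fun r u => Subtype.ext (funext fun z => by
        simp only [Submodule.coe_smul, Pi.smul_apply, RingHom.id_apply]
        split_ifs
        · rw [smul_zero]
        · rfl) }
  have hE : ∀ u z (hz : z ∉ range γ), (E u : ℂ → ℂ) z = u (π z hz) := fun u z hz => dif_pos hz
  refine ⟨LinearEquiv.ofBijective E ⟨fun u v huv => funext fun C => ?_, fun f => ?_⟩⟩
  · obtain ⟨C, z, hz, rfl⟩ := C
    rw [← hE u z hz, ← hE v z hz, huv]
  · have hf : ∀ C : ↥(componentsIn (range γ)ᶜ), ∃ c, ∀ z ∈ (C : Set ℂ), (f : ℂ → ℂ) z = c := by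
      rintro ⟨C, z, hz, rfl⟩
      obtain ⟨c, hc⟩ := (isPreconnected_connectedComponentIn
        (F := (range γ)ᶜ) (x := z)).exists_eq_of_eventually_const (D := univ) (f := (f : ℂ → ℂ))
        (fun x _ => by rw [nhdsWithin_univ]; infer_instance) (fun x hx => ⟨_, by
          rw [nhdsWithin_univ]
          exact f.2.1 x (connectedComponentIn_subset _ _ hx)⟩)
      exact ⟨c, fun y hy => hc y ⟨trivial, hy⟩⟩
    choose u hu using hf
    refine ⟨u, Subtype.ext (funext fun z => ?_)⟩
    by_cases hz : z ∈ range γ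
    · rw [f.2.2 z hz]
      exact (E u).2.2 z hz
    · rw [hE u z hz]
      exact (hu _ z (mem_connectedComponentIn (F := (range γ)ᶜ) hz)).symm

theorem IsImmersedLoop.ncard_bounded_components {γ : ℝ → ℂ} (h : IsImmersedLoop γ) :
    {C | C ∈ componentsIn (range γ)ᶜ ∧ IsBounded C}.ncard +
      (γ '' (multipleParams γ ∩ Ico 0 1)).ncard = (multipleParams γ ∩ Ico 0 1).ncard + 1 := by
  classical
  obtain ⟨e⟩ := exists_linearEquiv_locConstOff h.isCompact_range.isClosed
  obtain ⟨hV, hdim⟩ := h.finrank_locConstOff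
  have := Module.Finite.equiv e.symm
  have hfin : Finite ↥(componentsIn (range γ)ᶜ) :=
    (Pi.linearIndependent_single_one ↥(componentsIn (range γ)ᶜ) ℂ).finite
  have := Fintype.ofFinite ↥(componentsIn (range γ)ᶜ)
  have h1 := e.finrank_eq
  rw [Module.finrank_fintype_fun_eq_card, Fintype.card_eq_nat_card, Nat.card_coe_set_eq,
    ncard_componentsIn_compl_eq h.isCompact_range (toFinite _)] at h1
  omega

theorem ncard_eq_ncard_add_finsum {α β : Type*} {f : α → β} {s : Set α} {t : Set β}
    (hf : SurjOn f s t) (ht : t.Finite) (hfib : ∀ p ∈ t, (f ⁻¹' {p} ∩ s).Finite) :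
    (f ⁻¹' t ∩ s).Finite ∧
      (f ⁻¹' t ∩ s).ncard = t.ncard + ∑ᶠ p ∈ t, ((f ⁻¹' {p} ∩ s).ncard - 1) := by
  classical
  have hfin : (f ⁻¹' t ∩ s).Finite := (ht.biUnion hfib).subset fun x hx =>
    mem_biUnion hx.1 ⟨rfl, hx.2⟩
  refine ⟨hfin, ?_⟩
  rw [ncard_eq_toFinset_card _ hfin, ncard_eq_toFinset_card _ ht,
    finsum_mem_eq_finite_toFinset_sum _ ht, Finset.card_eq_sum_card_fiberwise (f := f)
      (t := ht.toFinset) fun x hx => by simpa using (hfin.mem_toFinset.1 hx).1,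
    Finset.card_eq_sum_ones, ← Finset.sum_add_distrib]
  refine Finset.sum_congr rfl fun p hp => ?_
  have hp := ht.mem_toFinset.1 hp
  have h1 : ((hfin.toFinset.filter fun x => f x = p : Finset α) : Set α) = f ⁻¹' {p} ∩ s := by
    ext x
    simp only [Finset.coe_filter, Finite.mem_toFinset, mem_inter_iff, mem_preimage,
      mem_singleton_iff, mem_ofPred_eq]
    exact ⟨fun h => ⟨h.2, h.1.2⟩, fun h => ⟨⟨h.1 ▸ hp, h.2⟩, h.1⟩⟩
  rw [← ncard_coe_finset, h1]
  obtain ⟨x, hx, hxp⟩ := hf hp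
  have := (ncard_pos (hfib p hp)).2 ⟨x, hxp, hx⟩
  omega

theorem Homeomorph.image_componentsIn {X Y : Type*} [TopologicalSpace X] [TopologicalSpace Y]
    (e : X ≃ₜ Y) (F : Set X) : Set.image e '' componentsIn F = componentsIn (e '' F) := by
  ext C
  constructor
  · rintro ⟨_, ⟨x, hx, rfl⟩, rfl⟩
    exact ⟨e x, mem_image_of_mem e hx, e.image_connectedComponentIn hx⟩
  · rintro ⟨_, ⟨x, hx, rfl⟩, rfl⟩
    exact ⟨_, ⟨x, hx, rfl⟩, e.image_connectedComponentIn hx⟩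

theorem multipleParams_inter_Ico {γ : ℝ → ℂ} (hγ : Periodic γ 1) :
    multipleParams γ ∩ Ico 0 1 =
      {t | t ∈ Ico (0 : ℝ) 1 ∧ ∃ s ∈ Ico (0 : ℝ) 1, s ≠ t ∧ γ s = γ t} := by
  ext t
  constructor
  · rintro ⟨⟨s, hs, hst⟩, ht⟩
    refine ⟨ht, Int.fract s, ⟨Int.fract_nonneg s, Int.fract_lt_one s⟩, fun h0 => ?_, ?_⟩
    · exact hst ⌊s⌋ (by rw [← h0, Int.fract_add_floor])
    · rw [← hs, ← Int.self_sub_floor]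
      simpa using hγ.sub_int_mul_eq (x := s) ⌊s⌋
  · rintro ⟨ht, s, hs, hst, h1⟩
    refine ⟨⟨s, h1, fun n hn => hst ?_⟩, ht⟩
    rw [← Int.fract_eq_self.2 hs, ← Int.fract_eq_self.2 ht, hn, Int.fract_add_intCast]

end

/-- An immersed closed C¹ curve in the plane (modeled as a 1-periodic map `γ : ℝ → ℝ × ℝ`)
with only transverse self-intersections and `k` self-intersection points counted with
multiplicity encloses exactly `k + 1` bounded connected components of the complement
of its image. -/
theorem immersed_curve_encloses_k_add_one_domains
    (γ : ℝ → ℝ × ℝ) (k : ℕ)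
    (hper : Periodic γ 1)
    (hC1 : ContDiff ℝ 1 γ)
    (himm : ∀ t : ℝ, deriv γ t ≠ 0)
    (htrans : ∀ s ∈ Ico (0:ℝ) 1, ∀ t ∈ Ico (0:ℝ) 1, s ≠ t → γ s = γ t →
      LinearIndependent ℝ ![deriv γ s, deriv γ t])
    (S : Set (ℝ × ℝ))
    (hS : S = {p | ∃ s ∈ Ico (0:ℝ) 1, ∃ t ∈ Ico (0:ℝ) 1, s ≠ t ∧ γ s = p ∧ γ t = p})
    (hSfin : S.Finite)
    (hfib : ∀ p ∈ S, (γ ⁻¹' {p} ∩ Ico (0:ℝ) 1).Finite)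
    (hk : ∑ᶠ p ∈ S, ((γ ⁻¹' {p} ∩ Ico (0:ℝ) 1).ncard - 1) = k) :
    {C : Set (ℝ × ℝ) |
        (∃ x ∈ (range γ)ᶜ, C = connectedComponentIn (range γ)ᶜ x) ∧ IsBounded C}.ncard
      = k + 1 := by
  set e : (ℝ × ℝ) ≃L[ℝ] ℂ := Complex.equivRealProdCLM.symm
  have hmult : multipleParams (e ∘ γ) ∩ Ico 0 1 = γ ⁻¹' S ∩ Ico 0 1 := by
    rw [multipleParams_inter_Ico (hper.comp e)]
    ext t
    simp only [hS, mem_ofPred_eq, mem_inter_iff, mem_preimage, comp_apply, e.injective.eq_iff]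
    constructor
    · rintro ⟨ht, s, hs, hst, h1⟩
      exact ⟨⟨s, hs, t, ht, hst, h1, rfl⟩, ht⟩
    · rintro ⟨⟨s, hs, u, hu, hsu, h1, h2⟩, ht⟩
      by_cases hst : s = t
      · exact ⟨ht, u, hu, fun h3 => hsu (hst.trans h3.symm), h2⟩
      · exact ⟨ht, s, hs, hst, h1⟩
  have hsurj : SurjOn γ (Ico 0 1) S := by
    rw [hS]
    rintro p ⟨s, hs, -, -, -, h1, -⟩
    exact ⟨s, hs, h1⟩
  obtain ⟨hfin, hcard⟩ := ncard_eq_ncard_add_finsum hsurj hSfin hfib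
  rw [hk] at hcard
  have h : IsImmersedLoop (e ∘ γ) :=
    { periodic := hper.comp e
      contDiff := e.contDiff.comp hC1
      deriv_ne_zero := fun t h0 => himm t (by
        have h1 := e.hasFDerivAt.comp_hasDerivAt t (hC1.differentiable one_ne_zero t).hasDerivAt
        rw [h1.deriv] at h0
        exact e.map_eq_zero_iff.1 h0)
      finite_multipleParams := hmult ▸ hfin }
  have hmain := h.ncard_bounded_components
  have himage : (e ∘ γ) '' (γ ⁻¹' S ∩ Ico 0 1) = e '' S := by
    rw [image_comp, inter_comm, image_inter_preimage, inter_eq_right.2 hsurj]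
  have hcomp : {C | C ∈ componentsIn (range (e ∘ γ))ᶜ ∧ IsBounded C} =
      image e '' {C | C ∈ componentsIn (range γ)ᶜ ∧ IsBounded C} := by
    have h1 := e.toHomeomorph.image_componentsIn (range γ)ᶜ
    rw [image_compl_eq e.toHomeomorph.bijective, ← range_comp] at h1
    have hb : ∀ C, IsBounded (e '' C) ↔ IsBounded C := fun C =>
      ⟨fun hC => by
        simpa [image_image] using e.symm.lipschitz.isBounded_image hC,
        fun hC => e.lipschitz.isBounded_image hC⟩
    ext C
    constructor
    · rintro ⟨hC, hCb⟩
      obtain ⟨C, hC', rfl⟩ := h1.symm.subset hC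
      exact ⟨C, ⟨hC', (hb C).1 hCb⟩, rfl⟩
    · rintro ⟨C, ⟨hC, hCb⟩, rfl⟩
      exact ⟨h1.subset (mem_image_of_mem _ hC), (hb C).2 hCb⟩
  rw [hmult, himage, hcomp, ncard_image_of_injective _ (image_injective.2 e.injective),
    ncard_image_of_injective _ e.injective, hcard] at hmain
  change {C | C ∈ componentsIn (range γ)ᶜ ∧ IsBounded C}.ncard = k + 1
  omega
end

section
/- Let γ : 𝕊¹ → ℝ² be a C¹ immersed closed curve (γ'(t) ≠ 0 for all t) all of whose self-intersection points are transverse, and with only finitely many self-intersection points, each having a finite fiber γ⁻¹(p). Then the image of γ is contained in the union of the closures of the bounded connected components of ℝ² \ Image(γ); i.e., every point of Image(γ) lies in the closure of some bounded component of the complement. -/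
open Set Function Bornology
open Filter Topology

/-- The integral of `deriv g t / (g t - x)` over `t` from `a` to `b`. -/
noncomputable def windingIntegral (g : ℝ → ℂ) (a b : ℝ) (x : ℂ) : ℂ :=
  ∫ t in a..b, deriv g t / (g t - x)

theorem continuousOn_deriv_div_sub {g : ℝ → ℂ} (hg : ContDiff ℝ 1 g) {s : Set ℝ} {x : ℂ}
    (hx : x ∉ g '' s) : ContinuousOn (fun t => deriv g t / (g t - x)) s :=
  (hg.continuous_deriv le_rfl).continuousOn.div (by have := hg.continuous; fun_prop)
    fun t ht h => hx ⟨t, ht, sub_eq_zero.1 h⟩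

theorem continuousOn_windingIntegral {g : ℝ → ℂ} (hg : ContDiff ℝ 1 g) {a b : ℝ} (hab : a ≤ b) :
    ContinuousOn (windingIntegral g a b) (g '' Icc a b)ᶜ := by
  rw [continuousOn_iff_continuous_domRestrict]
  have hd := hg.continuous_deriv le_rfl
  have hc := hg.continuous
  have key : Continuous fun x : ↥(g '' Icc a b)ᶜ =>
      ∫ t in a..b, deriv g t / (g (projIcc a b hab t) - x) := by
    apply intervalIntegral.continuous_parametric_intervalIntegral_of_continuous'
    refine Continuous.div (by fun_prop) ?_ ?_
    · exact (hc.comp (continuous_subtype_val.comp (continuous_projIcc.comp continuous_snd))).sub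
        (continuous_subtype_val.comp continuous_fst)
    · rintro ⟨x, t⟩ h
      exact x.2 ⟨_, (projIcc a b hab t).2, sub_eq_zero.1 h⟩
  refine key.congr fun x => ?_
  refine intervalIntegral.integral_congr fun t ht => ?_
  rw [uIcc_of_le hab] at ht
  simp [projIcc_of_mem hab ht]

theorem exp_windingIntegral {g : ℝ → ℂ} (hg : ContDiff ℝ 1 g) {a b : ℝ} (hab : g a = g b) {x : ℂ}
    (hx : x ∉ range g) : Complex.exp (windingIntegral g a b x) = 1 := by
  have hc : Continuous fun t => deriv g t / (g t - x) := by
    rw [← continuousOn_univ]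
    exact continuousOn_deriv_div_sub hg (by rwa [image_univ])
  have hne : ∀ t, g t - x ≠ 0 := fun t h => hx ⟨t, sub_eq_zero.1 h⟩
  have hder : ∀ t, HasDerivAt (fun t => Complex.exp (-windingIntegral g a t x) * (g t - x)) 0 t := by
    intro t
    have h1 : HasDerivAt (fun t => windingIntegral g a t x) (deriv g t / (g t - x)) t :=
      intervalIntegral.integral_hasDerivAt_right (hc.intervalIntegrable _ _)
        (hc.stronglyMeasurableAtFilter _ _) hc.continuousAt
    have h2 : HasDerivAt g (deriv g t) t := (hg.differentiable one_ne_zero t).hasDerivAt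
    have h3 : deriv g t / (g t - x) * (g t - x) = deriv g t := div_mul_cancel₀ _ (hne t)
    refine (h1.fun_neg.cexp.fun_mul (h2.sub_const x)).congr_deriv ?_
    linear_combination -Complex.exp (-windingIntegral g a t x) * h3
  have hconst := is_const_of_deriv_eq_zero (fun t => (hder t).differentiableAt)
    (fun t => (hder t).deriv) a b
  have ha : windingIntegral g a a x = 0 := by simp [windingIntegral]
  simp only [ha, neg_zero, Complex.exp_zero, one_mul, hab] at hconst
  have h3 : Complex.exp (-windingIntegral g a b x) = 1 :=
    mul_right_cancel₀ (hne b) (by rw [one_mul]; exact hconst.symm)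
  rw [Complex.exp_neg, inv_eq_one] at h3
  exact h3

theorem isDiscrete_setOf_exp_eq_one : IsDiscrete {z : ℂ | Complex.exp z = 1} := by
  have h : {z : ℂ | Complex.exp z = 1} = AddSubgroup.zmultiples (2 * Real.pi * Complex.I) := by
    ext z
    simp [Complex.exp_eq_one_iff, AddSubgroup.mem_zmultiples_iff, eq_comm]
  rw [h]
  exact ⟨NormedSpace.discreteTopology_zmultiples _⟩

/-- Winding integrals of a closed curve vanish on unbounded components of the complement. -/
theorem isBounded_component_of_windingIntegral_ne_zero {g : ℝ → ℂ} (hg : ContDiff ℝ 1 g)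
    (hper : Periodic g 1) (a : ℝ) {x : ℂ} (hx : x ∈ (range g)ᶜ)
    (hw : windingIntegral g a (a + 1) x ≠ 0) :
    IsBounded (connectedComponentIn (range g)ᶜ x) := by
  set C := connectedComponentIn (range g)ᶜ x
  have hCsub : C ⊆ (range g)ᶜ := connectedComponentIn_subset _ _
  have hle : a ≤ a + 1 := by linarith
  obtain ⟨y, -, hy⟩ := (isPreconnected_connectedComponentIn (F := (range g)ᶜ)
    (x := x)).eqOn_const_of_mapsTo isDiscrete_setOf_exp_eq_one
    ((continuousOn_windingIntegral hg hle).mono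
      (hCsub.trans (compl_subset_compl.2 (image_subset_range _ _))))
    (fun z hz => exp_windingIntegral hg (hper a).symm (hCsub hz)) ⟨0, Complex.exp_zero⟩
  have hval : ∀ z ∈ C, windingIntegral g a (a + 1) z = windingIntegral g a (a + 1) x :=
    fun z hz => (hy hz).trans (hy (mem_connectedComponentIn hx)).symm
  obtain ⟨M, hM⟩ := isCompact_Icc.exists_bound_of_continuousOn (s := Icc a (a + 1))
    (hg.continuous_deriv le_rfl).continuousOn
  obtain ⟨R, hR⟩ := isCompact_Icc.exists_bound_of_continuousOn (s := Icc a (a + 1))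
    hg.continuous.continuousOn
  set w := ‖windingIntegral g a (a + 1) x‖ with hwdef
  have hwpos : 0 < w := norm_pos_iff.2 hw
  have hM0 : 0 ≤ M := (norm_nonneg _).trans (hM a ⟨le_rfl, hle⟩)
  refine isBounded_iff_forall_norm_le.2 ⟨R + (M / w + 1), fun z hz => ?_⟩
  by_contra! hlt
  have hpos : 0 < M / w + 1 := by positivity
  have hb : ‖windingIntegral g a (a + 1) z‖ ≤ M / (M / w + 1) * |a + 1 - a| := by
    refine intervalIntegral.norm_integral_le_of_norm_le_const fun t ht => ?_
    rw [uIoc_of_le hle] at ht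
    have ht' := Ioc_subset_Icc_self ht
    rw [norm_div]
    have h1 : M / w + 1 ≤ ‖g t - z‖ := by
      have := norm_sub_norm_le z (g t)
      rw [norm_sub_rev] at this
      linarith [hR t ht']
    exact div_le_div₀ hM0 (hM t ht') hpos h1
  rw [hval z hz, ← hwdef] at hb
  simp only [add_sub_cancel_left, abs_one, mul_one] at hb
  rw [le_div_iff₀ hpos, mul_add, mul_div_cancel₀ _ hwpos.ne'] at hb
  linarith

theorem mul_sub_mem_slitPlane {g : ℝ → ℂ} {J : Set ℝ} (hmono : StrictMonoOn (fun t => (g t).re) J)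
    {t₁ t : ℝ} (ht₁ : t₁ ∈ J) (ht : t ∈ J) {u : ℂ} (hu : u = Complex.I ∨ u = -Complex.I) {ε : ℝ}
    (hε : 0 < ε ∨ t ≠ t₁) : u * (g t - g t₁) + ε ∈ Complex.slitPlane := by
  rw [Complex.mem_slitPlane_iff]
  by_cases h : t = t₁
  · left
    simpa [h] using hε
  · right
    have := mt (hmono.injOn ht ht₁) h
    rcases hu with rfl | rfl <;> simpa [sub_eq_zero, neg_add_eq_zero, eq_comm] using this

theorem notMem_image_of_strictMonoOn_re {g : ℝ → ℂ} {J : Set ℝ}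
    (hmono : StrictMonoOn (fun t => (g t).re) J) {t₁ : ℝ} (ht₁ : t₁ ∈ J) {u : ℂ}
    (hu : u = Complex.I ∨ u = -Complex.I) {ε : ℝ} (hε : ε ≠ 0) : g t₁ + u * ε ∉ g '' J := by
  rintro ⟨t, ht, h⟩
  have hre : (g t).re = (g t₁).re := by rcases hu with rfl | rfl <;> simp [h]
  rw [hmono.injOn ht ht₁ hre] at h
  rcases hu with rfl | rfl <;> simp [hε] at h

theorem windingIntegral_eq_log_sub_log {g : ℝ → ℂ} (hg : ContDiff ℝ 1 g) {a b : ℝ} (hab : a ≤ b)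
    (hmono : StrictMonoOn (fun t => (g t).re) (Icc a b)) {t₁ : ℝ} (ht₁ : t₁ ∈ Icc a b) {u : ℂ}
    (hu : u = Complex.I ∨ u = -Complex.I) {ε : ℝ} (hε : 0 < ε) :
    windingIntegral g a b (g t₁ + u * ε) =
      Complex.log (u * (g b - g t₁) + ε) - Complex.log (u * (g a - g t₁) + ε) := by
  have hu2 : u * u = -1 := by rcases hu with rfl | rfl <;> simp
  have hu0 : u ≠ 0 := by rcases hu with rfl | rfl <;> simp
  refine intervalIntegral.integral_eq_sub_of_hasDerivAt
    (f := fun t => Complex.log (u * (g t - g t₁) + ε)) (fun t ht => ?_) ?_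
  · rw [uIcc_of_le hab] at ht
    have h2 : HasDerivAt g (deriv g t) t := (hg.differentiable one_ne_zero t).hasDerivAt
    have h3 := (((h2.sub_const (g t₁)).const_mul u).add_const (ε : ℂ)).clog_real
      (mul_sub_mem_slitPlane hmono ht₁ ht hu (.inl hε))
    refine h3.congr_deriv ?_
    rw [show u * (g t - g t₁) + ε = u * (g t - (g t₁ + u * ε)) by
      linear_combination (ε : ℂ) * hu2, mul_div_mul_left _ _ hu0]
  · refine ContinuousOn.intervalIntegrable ?_
    rw [uIcc_of_le hab]
    exact continuousOn_deriv_div_sub hg (notMem_image_of_strictMonoOn_re hmono ht₁ hu hε.ne')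

theorem tendsto_windingIntegral_local {g : ℝ → ℂ} (hg : ContDiff ℝ 1 g) {a b c t₁ : ℝ}
    (hmono : StrictMonoOn (fun t => (g t).re) (Icc a b)) (hat : a < t₁) (htb : t₁ < b) (hbc : b ≤ c)
    (hK : g t₁ ∉ g '' Icc b c) {u : ℂ} (hu : u = Complex.I ∨ u = -Complex.I) :
    Tendsto (fun ε : ℝ => windingIntegral g a c (g t₁ + u * ε)) (𝓝[>] 0)
      (𝓝 (Complex.log (u * (g b - g t₁)) - Complex.log (u * (g a - g t₁)) +
        windingIntegral g b c (g t₁))) := by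
  have hab : a ≤ b := (hat.trans htb).le
  have ht₁ : t₁ ∈ Icc a b := ⟨hat.le, htb.le⟩
  have hKopen : IsOpen (g '' Icc b c)ᶜ :=
    (isCompact_Icc.image hg.continuous).isClosed.isOpen_compl
  have hx : Tendsto (fun ε : ℝ => g t₁ + u * ε) (𝓝[>] 0) (𝓝 (g t₁)) := by
    have : Continuous fun ε : ℝ => g t₁ + u * ε := by fun_prop
    simpa using (this.tendsto 0).mono_left nhdsWithin_le_nhds
  have hlog : ∀ t ∈ Icc a b, t ≠ t₁ → Tendsto (fun ε : ℝ => Complex.log (u * (g t - g t₁) + ε))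
      (𝓝[>] 0) (𝓝 (Complex.log (u * (g t - g t₁)))) := by
    intro t ht hne
    have hs := mul_sub_mem_slitPlane hmono ht₁ ht hu (ε := 0) (.inr hne)
    have hc : Tendsto (fun ε : ℝ => u * (g t - g t₁) + ε) (𝓝[>] 0)
        (𝓝 (u * (g t - g t₁) + (0 : ℝ))) := by
      have : Continuous fun ε : ℝ => u * (g t - g t₁) + ε := by fun_prop
      exact (this.tendsto 0).mono_left nhdsWithin_le_nhds
    simpa using hc.clog hs
  have hfar : Tendsto (fun ε : ℝ => windingIntegral g b c (g t₁ + u * ε)) (𝓝[>] 0)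
      (𝓝 (windingIntegral g b c (g t₁))) :=
    (((continuousOn_windingIntegral hg hbc).continuousAt (hKopen.mem_nhds hK)).tendsto).comp hx
  refine (((hlog b ⟨hab, le_rfl⟩ htb.ne').sub (hlog a ⟨le_rfl, hab⟩ hat.ne)).add hfar).congr' ?_
  filter_upwards [self_mem_nhdsWithin, hx.eventually (hKopen.mem_nhds hK)] with ε hε hεK
  rw [← windingIntegral_eq_log_sub_log hg hab hmono ht₁ hu hε]
  refine intervalIntegral.integral_add_adjacent_intervals
    (ContinuousOn.intervalIntegrable ?_) (ContinuousOn.intervalIntegrable ?_)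
  · rw [uIcc_of_le hab]
    exact continuousOn_deriv_div_sub hg (notMem_image_of_strictMonoOn_re hmono ht₁ hu hε.ne')
  · rw [uIcc_of_le hbc]
    exact continuousOn_deriv_div_sub hg hεK

/-- The winding integral jumps by `2πi` across a simple point of the curve. -/
theorem tendsto_windingIntegral_sub {g : ℝ → ℂ} (hg : ContDiff ℝ 1 g) {a b c t₁ : ℝ}
    (hmono : StrictMonoOn (fun t => (g t).re) (Icc a b)) (hat : a < t₁) (htb : t₁ < b) (hbc : b ≤ c)
    (hK : g t₁ ∉ g '' Icc b c) :
    Tendsto (fun ε : ℝ => windingIntegral g a c (g t₁ + Complex.I * ε) -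
      windingIntegral g a c (g t₁ + -Complex.I * ε)) (𝓝[>] 0) (𝓝 (2 * Real.pi * Complex.I)) := by
  have h := (tendsto_windingIntegral_local hg hmono hat htb hbc hK (.inl rfl)).sub
    (tendsto_windingIntegral_local hg hmono hat htb hbc hK (.inr rfl))
  convert h using 2
  have ht₁ : t₁ ∈ Icc a b := ⟨hat.le, htb.le⟩
  have hb : 0 < (Complex.I * (g b - g t₁)).im := by
    simpa using hmono ht₁ ⟨ht₁.1.trans ht₁.2, le_rfl⟩ htb
  have ha : (Complex.I * (g a - g t₁)).im < 0 := by
    simpa using hmono ⟨le_rfl, ht₁.1.trans ht₁.2⟩ ht₁ hat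
  rw [neg_mul, neg_mul, Complex.log, Complex.log, Complex.log, Complex.log,
    Complex.arg_neg_eq_arg_sub_pi_of_im_pos hb, Complex.arg_neg_eq_arg_add_pi_of_im_neg ha,
    norm_neg, norm_neg]
  push_cast
  ring

theorem eventually_add_mul_notMem_range {g : ℝ → ℂ} (hg : Continuous g) (hper : Periodic g 1)
    {a b t : ℝ} (hmono : StrictMonoOn (fun t => (g t).re) (Icc a b)) (ht : t ∈ Ioo a b)
    (hK : g t ∉ g '' Icc b (a + 1)) {u : ℂ} (hu : u = Complex.I ∨ u = -Complex.I) :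
    ∀ᶠ p : ℝ × ℝ in 𝓝 (t, 0), p.2 ≠ 0 → g p.1 + u * p.2 ∉ range g := by
  have hKopen : IsOpen (g '' Icc b (a + 1))ᶜ := (isCompact_Icc.image hg).isClosed.isOpen_compl
  have hx : Tendsto (fun p : ℝ × ℝ => g p.1 + u * p.2) (𝓝 (t, 0)) (𝓝 (g t)) := by
    have : Continuous fun p : ℝ × ℝ => g p.1 + u * p.2 := by fun_prop
    simpa using this.tendsto (t, 0)
  filter_upwards [hx.eventually (hKopen.mem_nhds hK),
    continuous_fst.continuousAt.eventually (isOpen_Ioo.mem_nhds ht)] with p hpK hp hp0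
  rintro ⟨s, hs⟩
  obtain ⟨s', hs', hss'⟩ := hper.exists_mem_Ico one_pos s a
  rw [hss'] at hs
  rcases le_or_gt b s' with h | h
  · exact hpK ⟨s', ⟨h, hs'.2.le⟩, hs⟩
  · exact notMem_image_of_strictMonoOn_re hmono (Ioo_subset_Icc_self hp) hu hp0
      ⟨s', ⟨hs'.1, h.le⟩, hs⟩

theorem exists_connectedComponentIn_eq {g : ℝ → ℂ} (hg : Continuous g) {t : ℝ} {u : ℂ}
    (h : ∀ᶠ p : ℝ × ℝ in 𝓝 (t, 0), p.2 ≠ 0 → g p.1 + u * p.2 ∉ range g) :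
    ∃ r > 0, ∀ s ∈ Metric.ball t r, ∀ ε ∈ Ioo 0 r, g s + u * ε ∈ (range g)ᶜ ∧
      ∀ s' ∈ Metric.ball t r, ∀ ε' ∈ Ioo 0 r,
        connectedComponentIn (range g)ᶜ (g s + u * ε) =
          connectedComponentIn (range g)ᶜ (g s' + u * ε') := by
  obtain ⟨r, hr, hball⟩ := Metric.eventually_nhds_iff_ball.1 h
  set T := (fun p : ℝ × ℝ => g p.1 + u * p.2) '' (Metric.ball t r ×ˢ Ioo 0 r)
  have hTpre : IsPreconnected T :=
    ((convex_ball t r).isPreconnected.prod isPreconnected_Ioo).image _ (by fun_prop)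
  have hTsub : T ⊆ (range g)ᶜ := by
    rintro _ ⟨p, ⟨hp1, hp2⟩, rfl⟩
    refine hball p ?_ hp2.1.ne'
    rw [← ball_prod_same]
    exact ⟨hp1, by simpa [abs_of_pos hp2.1] using hp2.2⟩
  have hmem : ∀ s ∈ Metric.ball t r, ∀ ε ∈ Ioo 0 r, g s + u * (ε : ℝ) ∈ T :=
    fun s hs ε hε => ⟨(s, ε), ⟨hs, hε⟩, rfl⟩
  refine ⟨r, hr, fun s hs ε hε => ⟨hTsub (hmem s hs ε hε), fun s' hs' ε' hε' => ?_⟩⟩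
  exact connectedComponentIn_eq
    (hTpre.subset_connectedComponentIn (hmem s hs ε hε) hTsub (hmem s' hs' ε' hε'))

theorem exists_bounded_component_mem_closure {g : ℝ → ℂ} (hg : ContDiff ℝ 1 g)
    (hper : Periodic g 1) {t₀ : ℝ} (hre : 0 < (deriv g t₀).re)
    (hsimple : ∀ᶠ t in 𝓝[>] t₀, ∀ s, g s = g t → ∃ k : ℤ, s = t + k) :
    ∃ x ∈ (range g)ᶜ, IsBounded (connectedComponentIn (range g)ᶜ x) ∧
      g t₀ ∈ closure (connectedComponentIn (range g)ᶜ x) := by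
  have hd := hg.continuous_deriv le_rfl
  obtain ⟨η, hη, hpos⟩ := Metric.eventually_nhds_iff_ball.1
    ((Complex.continuous_re.comp hd).continuousAt.eventually (lt_mem_nhds hre))
  obtain ⟨δ, hδ, hδs⟩ := mem_nhdsGT_iff_exists_Ioo_subset.1 hsimple
  rw [mem_Ioi] at hδ
  set a := t₀ - min (η / 2) (1 / 4) with ha
  set b := t₀ + min (η / 2) (1 / 4) with hb
  have hm : 0 < min (η / 2) (1 / 4) := by positivity
  have hm1 := min_le_left (η / 2) (1 / 4)
  have hm2 := min_le_right (η / 2) (1 / 4)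
  have hb1 : b ≤ a + 1 := by linarith
  have hmono : StrictMonoOn (fun t => (g t).re) (Icc a b) := by
    refine strictMonoOn_of_hasDerivWithinAt_pos (f' := fun t => (deriv g t).re) (convex_Icc a b)
      (Complex.continuous_re.comp hg.continuous).continuousOn (fun t _ => ?_) (fun t ht => ?_)
    · have h2 : HasDerivAt g (deriv g t) t := (hg.differentiable one_ne_zero t).hasDerivAt
      exact (Complex.reCLM.hasFDerivAt.comp_hasDerivAt t h2).hasDerivWithinAt
    · rw [interior_Icc] at ht
      refine hpos t ?_
      rw [Real.ball_eq_Ioo]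
      constructor <;> linarith [ht.1, ht.2]
  set A := Ioo t₀ (min δ b)
  have hAsub : ∀ t ∈ A, t ∈ Ioo a b := fun t ht =>
    ⟨by linarith [ht.1], ht.2.trans_le (min_le_right _ _)⟩
  have hK : ∀ t ∈ A, g t ∉ g '' Icc b (a + 1) := by
    rintro t ht ⟨s, hs, hst⟩
    obtain ⟨k, rfl⟩ := hδs ⟨ht.1, ht.2.trans_le (min_le_left _ _)⟩ s hst
    have := hAsub t ht
    have hk0 : (0 : ℝ) < k := by linarith [hs.1, this.2]
    have hk1 : (1 : ℝ) ≤ k := by exact_mod_cast Int.add_one_le_iff.2 (Int.cast_pos.1 hk0)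
    linarith [hs.2, this.1]
  have htube := fun t (ht : t ∈ A) u (hu : u = Complex.I ∨ u = -Complex.I) =>
    exists_connectedComponentIn_eq hg.continuous
      (eventually_add_mul_notMem_range hg.continuous hper hmono (hAsub t ht) (hK t ht) hu)
  have hlt : t₀ < min δ b := lt_min hδ (by linarith)
  obtain ⟨t₁, ht₁⟩ : A.Nonempty := nonempty_Ioo.2 hlt
  have hIoo : ∀ r > (0 : ℝ), ∀ᶠ ε in 𝓝[>] (0 : ℝ), ε ∈ Ioo 0 r := fun r hr => Ioo_mem_nhdsGT hr
  obtain ⟨u, hu, hw⟩ : ∃ u, (u = Complex.I ∨ u = -Complex.I) ∧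
      ∃ᶠ ε : ℝ in 𝓝[>] 0, windingIntegral g a (a + 1) (g t₁ + u * ε) ≠ 0 := by
    have hne : (2 * Real.pi * Complex.I : ℂ) ≠ 0 := by simp [Real.pi_ne_zero]
    have hev := (tendsto_windingIntegral_sub hg hmono (hAsub t₁ ht₁).1 (hAsub t₁ ht₁).2 hb1
      (hK t₁ ht₁)).eventually_ne hne
    by_contra! hcon
    obtain ⟨ε, h, h1, h2⟩ := (hev.and ((hcon _ (.inl rfl)).and (hcon _ (.inr rfl)))).exists
    exact h (by rw [h1, h2, sub_zero])
  obtain ⟨r, hr, hrT⟩ := htube t₁ ht₁ u hu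
  obtain ⟨ε₁, hw, hε₁⟩ := (hw.and_eventually (hIoo r hr)).exists
  have hx := (hrT t₁ (Metric.mem_ball_self hr) ε₁ hε₁).1
  refine ⟨_, hx, isBounded_component_of_windingIntegral_ne_zero hg hper a hx hw, ?_⟩
  have hcomp : ∀ t ∈ A, ∀ᶠ ε : ℝ in 𝓝[>] 0, connectedComponentIn (range g)ᶜ (g t₁ + u * ε) =
      connectedComponentIn (range g)ᶜ (g t + u * ε) := by
    intro t ht
    refine isPreconnected_Ioo.induction₂ (s := A) (fun s t => ∀ᶠ ε : ℝ in 𝓝[>] 0,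
      connectedComponentIn (range g)ᶜ (g s + u * ε) =
        connectedComponentIn (range g)ᶜ (g t + u * ε)) (fun s hs => ?_)
      (fun _ _ _ _ _ _ h1 h2 => ?_) (fun _ _ _ _ h => ?_) ht₁ ht
    · obtain ⟨r, hr, hrT⟩ := htube s hs u hu
      filter_upwards [nhdsWithin_le_nhds (Metric.ball_mem_nhds s hr)] with y hy
      filter_upwards [hIoo r hr] with ε hε
      exact (hrT s (Metric.mem_ball_self hr) ε hε).2 y hy ε hε
    · filter_upwards [h1, h2] with ε h1 h2 using h1.trans h2
    · filter_upwards [h] with ε h using h.symm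
  have hcl : ∀ t ∈ A, g t ∈ closure (connectedComponentIn (range g)ᶜ (g t₁ + u * ε₁)) := by
    intro t ht
    have hlim : Tendsto (fun ε : ℝ => g t + u * ε) (𝓝[>] 0) (𝓝 (g t)) := by
      have : Continuous fun ε : ℝ => g t + u * ε := by fun_prop
      simpa using (this.tendsto 0).mono_left nhdsWithin_le_nhds
    refine mem_closure_of_tendsto hlim ?_
    obtain ⟨r', hr', hrT'⟩ := htube t ht u hu
    filter_upwards [hcomp t ht, hIoo r hr, hIoo r' hr'] with ε hε h1 h2
    rw [(hrT t₁ (Metric.mem_ball_self hr) ε₁ hε₁).2 t₁ (Metric.mem_ball_self hr) ε h1, hε]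
    exact mem_connectedComponentIn (hrT' t (Metric.mem_ball_self hr') ε h2).1
  refine isClosed_closure.mem_of_tendsto
    (hg.continuous.continuousAt.tendsto.mono_left (nhdsWithin_le_nhds (s := Ioi t₀))) ?_
  filter_upwards [Ioo_mem_nhdsGT hlt] with t ht using hcl t ht

theorem eventually_simple_of_finite {E : Type*} {γ : ℝ → E} (hper : Periodic γ 1)
    (hfin : {t ∈ Ico (0 : ℝ) 1 | ∃ s ∈ Ico (0 : ℝ) 1, s ≠ t ∧ γ s = γ t}.Finite)
    {t₀ : ℝ} (ht₀ : t₀ ∈ Ico (0 : ℝ) 1) :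
    ∀ᶠ t in 𝓝[>] t₀, ∀ s, γ s = γ t → ∃ k : ℤ, s = t + k := by
  have hnhds := (hfin.sdiff (t := {t₀})).isClosed.isOpen_compl.mem_nhds (x := t₀) (by simp)
  filter_upwards [Ioo_mem_nhdsGT ht₀.2, nhdsWithin_le_nhds hnhds] with t ht htB s hs
  have htI : t ∈ Ico (0 : ℝ) 1 := ⟨ht₀.1.trans ht.1.le, ht.2⟩
  have hfr : γ (Int.fract s) = γ t := by
    rw [← hs, Int.fract]
    simpa using hper.sub_zsmul_eq (x := s) ⌊s⌋
  have heq : Int.fract s = t := by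
    by_contra hne
    exact htB ⟨⟨htI, _, ⟨Int.fract_nonneg s, Int.fract_lt_one s⟩, hne, hfr⟩, ht.1.ne'⟩
  exact ⟨⌊s⌋, by rw [← heq, Int.fract_add_floor]⟩

theorem exists_continuousLinearEquiv_re_pos {v : ℝ × ℝ} (hv : v ≠ 0) :
    ∃ L : (ℝ × ℝ) ≃L[ℝ] ℂ, 0 < (L v).re := by
  have hv' : Complex.equivRealProdCLM.symm v ≠ 0 := by simpa using hv
  refine ⟨Complex.equivRealProdCLM.symm.trans
    (ContinuousLinearEquiv.smulLeft (Units.mk0 _ hv')⁻¹), ?_⟩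
  change 0 < ((Complex.equivRealProdCLM.symm v)⁻¹ * Complex.equivRealProdCLM.symm v).re
  simp [inv_mul_cancel₀ hv']

/-- The image of an immersed closed C¹ curve in the plane (modeled as a 1-periodic map)
with finitely many transverse self-intersections, each with finite fiber, is contained in
the union of the closures of the bounded connected components of the complement. -/
theorem immersed_curve_image_subset_closure_of_bounded_components
    (γ : ℝ → ℝ × ℝ)
    (hper : Periodic γ 1)
    (hC1 : ContDiff ℝ 1 γ)
    (himm : ∀ t : ℝ, deriv γ t ≠ 0)
    (htrans : ∀ s ∈ Ico (0:ℝ) 1, ∀ t ∈ Ico (0:ℝ) 1, s ≠ t → γ s = γ t →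
      LinearIndependent ℝ ![deriv γ s, deriv γ t])
    (S : Set (ℝ × ℝ))
    (hS : S = {p | ∃ s ∈ Ico (0:ℝ) 1, ∃ t ∈ Ico (0:ℝ) 1, s ≠ t ∧ γ s = p ∧ γ t = p})
    (hSfin : S.Finite)
    (hfib : ∀ p ∈ S, (γ ⁻¹' {p} ∩ Ico (0:ℝ) 1).Finite) :
    ∀ p ∈ range γ, ∃ x ∈ (range γ)ᶜ,
      IsBounded (connectedComponentIn (range γ)ᶜ x) ∧
      p ∈ closure (connectedComponentIn (range γ)ᶜ x) := by
  rintro _ ⟨t, rfl⟩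
  obtain ⟨t₀, ht₀, htt₀⟩ := hper.exists_mem_Ico₀ one_pos t
  rw [htt₀]
  obtain ⟨L, hL⟩ := exists_continuousLinearEquiv_re_pos (himm t₀)
  have hfin : {t ∈ Ico (0 : ℝ) 1 | ∃ s ∈ Ico (0 : ℝ) 1, s ≠ t ∧ γ s = γ t}.Finite := by
    refine (hSfin.biUnion hfib).subset ?_
    rintro t ⟨ht, s, hs, hne, hst⟩
    refine mem_biUnion (x := γ t) ?_ ⟨rfl, ht⟩
    rw [hS]
    exact ⟨s, hs, t, ht, hne, hst, rfl⟩
  have hderiv : deriv (L ∘ γ) t₀ = L (deriv γ t₀) :=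
    (L.hasFDerivAt.comp_hasDerivAt t₀ (hC1.differentiable one_ne_zero t₀).hasDerivAt).deriv
  obtain ⟨x, hx, hbdd, hcl⟩ := exists_bounded_component_mem_closure (g := L ∘ γ) (t₀ := t₀)
    (L.contDiff.comp hC1) (fun t => congrArg L (hper t)) (by rwa [hderiv])
    ((eventually_simple_of_finite hper hfin ht₀).mono fun t ht s hs => ht s (L.injective hs))
  have himage : L.symm '' (range (L ∘ γ))ᶜ = (range γ)ᶜ := by
    rw [image_compl_eq L.symm.bijective, ← range_comp]
    congr 2
    ext1 t
    simp
  have hcomp := L.symm.toHomeomorph.image_connectedComponentIn hx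
  simp only [ContinuousLinearEquiv.coe_toHomeomorph, himage] at hcomp
  refine ⟨L.symm x, himage ▸ mem_image_of_mem _ hx, ?_, ?_⟩
  · rw [← hcomp]
    exact L.symm.lipschitz.isBounded_image hbdd
  · rw [← hcomp, ← L.symm.image_closure]
    exact ⟨_, hcl, by simp⟩
end
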